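/- arXiv:2405.15543 — 4 statements merged into one kernel-verified Lean document; each statement's English description precedes it below -/
import Mathlib

section
/- The class of all finite simple graphs that do not contain the house as an induced minor is tame. -/
open SimpleGraph

/-! ### Minimal separators, tame and feral classes -/

/-- `S` separates `a` from `b` in `G`: `a, b` lie in distinct connected components of `G − S`,
i.e. every walk from `a` to `b` meets `S`. -/
def Separates {V : Type} (G : SimpleGraph V) (S : Set V) (a b : V) : Prop :=
  ∀ p : G.Walk a b, ∃ x ∈ p.support, x ∈ S

/-- `S` is a minimal separator of `G`: some nonadjacent pair `a, b` outside `S` lies in distinct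
components of `G − S`, while for every proper subset `S' ⊊ S` they lie in the same component
of `G − S'`. -/
def IsMinimalSeparator {V : Type} (G : SimpleGraph V) (S : Set V) : Prop :=
  ∃ a b : V, a ∉ S ∧ b ∉ S ∧ a ≠ b ∧ ¬ G.Adj a b ∧ Separates G S a b ∧
    ∀ S' : Set V, S' ⊂ S → ¬ Separates G S' a b

/-- The number of minimal separators of a graph on `Fin n`. -/
noncomputable def numMinSep {n : ℕ} (G : SimpleGraph (Fin n)) : ℕ :=
  {S : Set (Fin n) | IsMinimalSeparator G S}.ncard

/-- A class of finite simple graphs (one collection for each number of vertices) is tame if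
some polynomial bounds the number of minimal separators of all its members. -/
def Tame (𝒢 : ∀ n : ℕ, SimpleGraph (Fin n) → Prop) : Prop :=
  ∃ p : Polynomial ℕ, ∀ (n : ℕ) (G : SimpleGraph (Fin n)), 𝒢 n G → numMinSep G ≤ p.eval n

/-- A class of finite simple graphs is feral if for some real `c > 1` there are infinitely many
graphs `G` in the class with at least `c ^ |V(G)|` minimal separators. -/
def Feral (𝒢 : ∀ n : ℕ, SimpleGraph (Fin n) → Prop) : Prop :=
  ∃ c : ℝ, 1 < c ∧ ∀ N : ℕ, ∃ n : ℕ, N ≤ n ∧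
    ∃ G : SimpleGraph (Fin n), 𝒢 n G ∧ (c ^ n : ℝ) ≤ (numMinSep G : ℝ)

/-! ### Minors and induced minors via models -/

/-- An induced minor model of `H` in `G`. -/
def IsInducedMinorModel {V W : Type} (G : SimpleGraph V) (H : SimpleGraph W)
    (X : W → Set V) : Prop :=
  (∀ w, (X w).Nonempty) ∧
  (∀ w, (G.induce (X w)).Connected) ∧
  (Pairwise fun u w => Disjoint (X u) (X w)) ∧
  (∀ u w, H.Adj u w → ∃ a ∈ X u, ∃ b ∈ X w, G.Adj a b) ∧
  (∀ u w, u ≠ w → ¬ H.Adj u w → ∀ a ∈ X u, ∀ b ∈ X w, ¬ G.Adj a b)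

/-- `H` is an induced minor of `G`. -/
def InducedMinor {V W : Type} (H : SimpleGraph W) (G : SimpleGraph V) : Prop :=
  ∃ X : W → Set V, IsInducedMinorModel G H X

/-- A minor model of `H` in `G` (edges between branch sets of nonadjacent vertices allowed). -/
def IsMinorModel {V W : Type} (G : SimpleGraph V) (H : SimpleGraph W)
    (X : W → Set V) : Prop :=
  (∀ w, (X w).Nonempty) ∧
  (∀ w, (G.induce (X w)).Connected) ∧
  (Pairwise fun u w => Disjoint (X u) (X w)) ∧
  (∀ u w, H.Adj u w → ∃ a ∈ X u, ∃ b ∈ X w, G.Adj a b)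

/-- `H` is a minor of `G`. -/
def IsMinorOf {V W : Type} (H : SimpleGraph W) (G : SimpleGraph V) : Prop :=
  ∃ X : W → Set V, IsMinorModel G H X

/-! ### Subdivisions -/

/-- The graph obtained from `H` by subdividing the edge `uv`: the new vertex is `none`, it is
joined to `u` and `v`, the edge `uv` is removed and everything else is unchanged. -/
def subdivideEdge {W : Type} (H : SimpleGraph W) (u v : W) : SimpleGraph (Option W) :=
  SimpleGraph.fromRel fun x y =>
    (∃ a b : W, x = some a ∧ y = some b ∧ H.Adj a b ∧ ¬(a = u ∧ b = v) ∧ ¬(a = v ∧ b = u)) ∨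
    (x = none ∧ (y = some u ∨ y = some v))

/-- `Subdivision H H'` holds when `H'` is obtained from `H` by repeatedly subdividing edges. -/
inductive Subdivision : {A : Type} → SimpleGraph A → {B : Type} → SimpleGraph B → Prop where
  | refl {A : Type} (G : SimpleGraph A) : Subdivision G G
  | step {A : Type} {G : SimpleGraph A} {B : Type} {H : SimpleGraph B} {u v : B} :
      Subdivision G H → H.Adj u v → Subdivision G (subdivideEdge H u v)

/-- `G` contains an induced subdivision of `H`, i.e. `H` is an induced topological minor
of `G`: some subdivision of `H` is isomorphic to an induced subgraph of `G`. -/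
def ContainsInducedSubdivision {A V : Type} (H : SimpleGraph A) (G : SimpleGraph V) : Prop :=
  ∃ (B : Type) (H' : SimpleGraph B), Subdivision H H' ∧ Nonempty (H' ↪g G)

/-! ### Particular graphs -/

/-- `2P₂`: the disjoint union of two edges. -/
def twoP2 : SimpleGraph (Fin 4) :=
  SimpleGraph.fromRel fun v w => (v = 0 ∧ w = 1) ∨ (v = 2 ∧ w = 3)

/-- The diamond: `K₄` minus the edge `03`. -/
def diamond : SimpleGraph (Fin 4) :=
  SimpleGraph.fromRel fun v w => ¬(v = 0 ∧ w = 3) ∧ ¬(v = 3 ∧ w = 0)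

/-- The butterfly: two triangles `{0,1,2}` and `{0,3,4}` sharing the vertex `0`. -/
def butterfly : SimpleGraph (Fin 5) :=
  SimpleGraph.fromRel fun v w =>
    (v = 0 ∧ w = 1) ∨ (v = 0 ∧ w = 2) ∨ (v = 1 ∧ w = 2) ∨
    (v = 0 ∧ w = 3) ∨ (v = 0 ∧ w = 4) ∨ (v = 3 ∧ w = 4)

/-- The house: the `5`-cycle `0-1-2-3-4-0` together with the chord `03`. -/
def house : SimpleGraph (Fin 5) :=
  SimpleGraph.fromRel fun v w =>
    (v = 0 ∧ w = 1) ∨ (v = 1 ∧ w = 2) ∨ (v = 2 ∧ w = 3) ∨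
    (v = 3 ∧ w = 4) ∨ (v = 0 ∧ w = 4) ∨ (v = 0 ∧ w = 3)

/-- `K₃ + P₁`: a triangle together with an isolated vertex. -/
def k3PlusP1 : SimpleGraph (Fin 4) :=
  SimpleGraph.fromRel fun v w => (v = 0 ∧ w = 1) ∨ (v = 0 ∧ w = 2) ∨ (v = 1 ∧ w = 2)

/-- The (short) `k`-theta: vertices `a = inl 0`, `b = inl 1`, `aᵢ = inr (i, 0)`,
`bᵢ = inr (i, 1)`, with edges `a aᵢ`, `aᵢ bᵢ`, `bᵢ b`. -/
def thetaGraph (k : ℕ) : SimpleGraph (Fin 2 ⊕ Fin k × Fin 2) :=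
  SimpleGraph.fromRel fun v w =>
    (∃ i, v = Sum.inl 0 ∧ w = Sum.inr (i, 0)) ∨
    (∃ i, v = Sum.inl 1 ∧ w = Sum.inr (i, 1)) ∨
    (∃ i, v = Sum.inr (i, 0) ∧ w = Sum.inr (i, 1))

/-- The (short) `k`-prism: two `k`-cliques `{(i,0)}` and `{(i,1)}` with a perfect matching. -/
def prismGraph (k : ℕ) : SimpleGraph (Fin k × Fin 2) :=
  SimpleGraph.fromRel fun v w => (v.2 = w.2 ∧ v.1 ≠ w.1) ∨ (v.1 = w.1 ∧ v.2 ≠ w.2)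

/-- The `k`-skinny ladder: paths `p_i = (i,0)`, `q_i = (i,1)`, independent set `r_i = (i,2)`,
with edges `p_i p_{i+1}`, `q_i q_{i+1}`, `p_i r_i`, `q_i r_i`. -/
def skinnyLadder (k : ℕ) : SimpleGraph (Fin k × Fin 3) :=
  SimpleGraph.fromRel fun v w =>
    (v.2 = w.2 ∧ v.2 ≠ 2 ∧ w.1.val = v.1.val + 1) ∨
    (v.1 = w.1 ∧ v.2 ≠ 2 ∧ w.2 = 2)

/-- `gammaGraph p q r` is the graph `Γ` consisting of two vertices `a = inl 0` and `b = inl 1`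
joined by three internally disjoint paths with `p`, `q`, `r` internal vertices respectively
(so of lengths `p+1`, `q+1`, `r+1`); i.e. `Γ_{p+1, q+1, r+1}`. -/
def gammaGraph (p q r : ℕ) : SimpleGraph (Fin 2 ⊕ (Fin p ⊕ (Fin q ⊕ Fin r))) :=
  SimpleGraph.fromRel fun v w =>
    match v, w with
    | Sum.inl x, Sum.inl y => x = 0 ∧ y = 1 ∧ (p = 0 ∨ q = 0 ∨ r = 0)
    | Sum.inl x, Sum.inr (Sum.inl t) => (x = 0 ∧ t.val = 0) ∨ (x = 1 ∧ t.val = p - 1)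
    | Sum.inl x, Sum.inr (Sum.inr (Sum.inl t)) => (x = 0 ∧ t.val = 0) ∨ (x = 1 ∧ t.val = q - 1)
    | Sum.inl x, Sum.inr (Sum.inr (Sum.inr t)) => (x = 0 ∧ t.val = 0) ∨ (x = 1 ∧ t.val = r - 1)
    | Sum.inr (Sum.inl t), Sum.inr (Sum.inl s) => s.val = t.val + 1
    | Sum.inr (Sum.inr (Sum.inl t)), Sum.inr (Sum.inr (Sum.inl s)) => s.val = t.val + 1
    | Sum.inr (Sum.inr (Sum.inr t)), Sum.inr (Sum.inr (Sum.inr s)) => s.val = t.val + 1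
    | _, _ => False

/-- The long twin wheel on a cycle of length `n`: the cycle `0-1-⋯-(n-1)-0` on `Fin n`
together with a center adjacent exactly to the consecutive vertices `0`, `1`, `2`. -/
def longTwinWheel (n : ℕ) : SimpleGraph (Fin n ⊕ Unit) :=
  SimpleGraph.fromRel fun v w =>
    match v, w with
    | Sum.inl a, Sum.inl b => b.val = a.val + 1 ∨ (a.val = n - 1 ∧ b.val = 0)
    | Sum.inl a, Sum.inr _ => a.val = 0 ∨ a.val = 1 ∨ a.val = 2
    | _, _ => False

/-! ### Thin walks -/

/-- A thin walk in `H`: a walk whose vertices are pairwise distinct except that possibly the two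
endpoints coincide, and all of whose internal vertices have degree `2` in `H`. -/
def IsThinWalk {V : Type} (H : SimpleGraph V) {x y : V} (p : H.Walk x y) : Prop :=
  p.support.tail.Nodup ∧ p.support.dropLast.Nodup ∧
    ∀ v ∈ p.support.tail.dropLast, (H.neighborSet v).ncard = 2

/-! ### Creatures -/

/-- A `k`-creature in `G` on the pairwise disjoint nonempty vertex sets `A`, `B`, `X`, `Y`. -/
def IsCreature {V : Type} (G : SimpleGraph V) (k : ℕ) (A B X Y : Set V) : Prop :=
  A.Nonempty ∧ B.Nonempty ∧
  Disjoint A B ∧ Disjoint A X ∧ Disjoint A Y ∧ Disjoint B X ∧ Disjoint B Y ∧ Disjoint X Y ∧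
  (G.induce A).Connected ∧ (G.induce B).Connected ∧
  (∀ a ∈ A, ∀ b ∈ B, ¬ G.Adj a b) ∧
  (∀ a ∈ A, ∀ y ∈ Y, ¬ G.Adj a y) ∧
  (∀ b ∈ B, ∀ x ∈ X, ¬ G.Adj b x) ∧
  (∀ x ∈ X, ∃ a ∈ A, G.Adj x a) ∧
  (∀ y ∈ Y, ∃ b ∈ B, G.Adj y b) ∧
  ∃ (x : Fin k → V) (y : Fin k → V), Function.Injective x ∧ Function.Injective y ∧
    X = Set.range x ∧ Y = Set.range y ∧ ∀ i j, G.Adj (x i) (y j) ↔ i = j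

/-- `G` is `k`-creature-free. -/
def CreatureFree {V : Type} (G : SimpleGraph V) (k : ℕ) : Prop :=
  ¬ ∃ A B X Y : Set V, IsCreature G k A B X Y

/-! ### Distance to minor-closed classes, feedback vertex set number -/

/-- `cFam F G`: the least size of a vertex set `S` such that `G − S` has no minor isomorphic
to a member of the family `F`. -/
noncomputable def cFam {V : Type} (F : ∀ n : ℕ, SimpleGraph (Fin n) → Prop)
    (G : SimpleGraph V) : ℕ :=
  sInf {k | ∃ S : Set V, S.ncard = k ∧
    ∀ (n : ℕ) (H : SimpleGraph (Fin n)), F n H → ¬ IsMinorOf H (G.induce Sᶜ)}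

/-- The feedback vertex set number of `G`. -/
noncomputable def fvs {V : Type} (G : SimpleGraph V) : ℕ :=
  sInf {k | ∃ S : Set V, S.ncard = k ∧ (G.induce Sᶜ).IsAcyclic}

/-! ### Long unichords and long thetas -/

/-- `G` has a long unichord: an edge which is the unique chord of some cycle of length ≥ 5. -/
def HasLongUnichord {V : Type} (G : SimpleGraph V) : Prop :=
  ∃ (v : V) (c : G.Walk v v), c.IsCycle ∧ 5 ≤ c.length ∧
    ∃ a b : V, a ∈ c.support ∧ b ∈ c.support ∧ G.Adj a b ∧ s(a, b) ∉ c.edges ∧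
      ∀ x y : V, x ∈ c.support → y ∈ c.support → G.Adj x y → s(x, y) ∉ c.edges →
        s(x, y) = s(a, b)

/-- `G` is long-theta-free: no induced subgraph of `G` is a theta `Γ_{i,j,k}` with
`i, j, k ≥ 2` and at least one of `i, j, k` at least `3`. -/
def LongThetaFree {V : Type} (G : SimpleGraph V) : Prop :=
  ¬ ∃ i j k : ℕ, 2 ≤ i ∧ 2 ≤ j ∧ 2 ≤ k ∧ (3 ≤ i ∨ 3 ≤ j ∨ 3 ≤ k) ∧
    Nonempty (gammaGraph (i - 1) (j - 1) (k - 1) ↪g G)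

/-! ### Helper lemmas on induced minor models -/

/-- If `H` is an induced minor of `G`, then so is every graph obtained from `H` by deleting
vertices and contracting a matching, the branch set of `u` being `{p u, q u}`. -/
theorem IsInducedMinorModel.inducedMinor_of_pairs {V W U : Type} {G : SimpleGraph V}
    {H : SimpleGraph W} {K : SimpleGraph U} {X : W → Set V} (hX : IsInducedMinorModel G H X)
    (p q : U → W) (hpq : ∀ u, p u = q u ∨ H.Adj (p u) (q u))
    (hne : ∀ u v, u ≠ v → p u ≠ p v ∧ p u ≠ q v ∧ q u ≠ q v)
    (hadj : ∀ u v, u ≠ v → (K.Adj u v ↔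
      H.Adj (p u) (p v) ∨ H.Adj (p u) (q v) ∨ H.Adj (q u) (p v) ∨ H.Adj (q u) (q v))) :
    InducedMinor K G := by
  obtain ⟨h1, h2, h3, h4, h5⟩ := hX
  refine ⟨fun u => X (p u) ∪ X (q u), fun u => (h1 _).mono Set.subset_union_left, fun u => ?_,
    fun u v huv => ?_, fun u v huv => ?_, fun u v huv hK => ?_⟩
  · rcases hpq u with h | h
    · beta_reduce
      rw [h, Set.union_self]
      exact h2 (q u)
    · obtain ⟨a, ha, b, hb, hab⟩ := h4 _ _ h
      exact connected_induce_union (h2 _).preconnected (h2 _).preconnected ha hb hab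
  · obtain ⟨ha, hb, hc⟩ := hne u v huv
    have hd := (hne v u huv.symm).2.1
    simp only [Set.disjoint_union_left, Set.disjoint_union_right]
    exact ⟨⟨h3 ha, h3 hd.symm⟩, h3 hb, h3 hc⟩
  · rcases (hadj u v huv.ne).1 huv with h | h | h | h <;>
    · obtain ⟨a, ha, b, hb, hab⟩ := h4 _ _ h
      exact ⟨a, by simp [ha], b, by simp [hb], hab⟩
  · obtain ⟨ha, hb, hc⟩ := hne u v huv
    have hd := (hne v u huv.symm).2.1
    have hn := mt (hadj u v huv).2 hK
    push Not at hn
    rintro a (haX | haX) b (hbX | hbX)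
    · exact h5 _ _ ha hn.1 a haX b hbX
    · exact h5 _ _ hb hn.2.1 a haX b hbX
    · exact h5 _ _ hd.symm hn.2.2.1 a haX b hbX
    · exact h5 _ _ hc hn.2.2.2 a haX b hbX

instance : DecidableRel house.Adj :=
  fun a b => decidable_of_iff _ (SimpleGraph.fromRel_adj _ a b).symm

/-- The `5`-cycle together with an apex `none` joined to the vertices selected by `N`. -/
def partialWheel (N : Fin 5 → Bool) : SimpleGraph (Option (Fin 5)) where
  Adj
    | some i, some j => (cycleGraph 5).Adj i j
    | none, some j => N j = true
    | some i, none => N i = true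
    | none, none => False
  symm := ⟨by rintro (_ | i) (_ | j) h <;> first | exact h | exact SimpleGraph.Adj.symm h⟩
  loopless := ⟨by rintro (_ | i) h <;> first | exact h | exact SimpleGraph.irrefl _ h⟩

instance (N : Fin 5 → Bool) : DecidableRel (partialWheel N).Adj
  | some i, some j => inferInstanceAs (Decidable ((cycleGraph 5).Adj i j))
  | none, some j => inferInstanceAs (Decidable (N j = true))
  | some i, none => inferInstanceAs (Decidable (N i = true))
  | none, none => inferInstanceAs (Decidable False)

/-- Up to rotation there are five ways to choose at least two, but not all, vertices of a
`5`-cycle. -/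
theorem exists_rotation_eq (N : Fin 5 → Bool) (h2 : ∃ i j, i ≠ j ∧ N i = true ∧ N j = true)
    (h5 : ∃ l, N l = false) :
    ∃ k, (fun i => N (i + k)) = ![true, true, false, false, false] ∨
      (fun i => N (i + k)) = ![true, false, true, false, false] ∨
      (fun i => N (i + k)) = ![true, true, true, false, false] ∨
      (fun i => N (i + k)) = ![true, false, true, true, false] ∨
      (fun i => N (i + k)) = ![true, false, true, true, true] := by
  revert N
  decide

theorem connected_induce_singleton {V : Type} (G : SimpleGraph V) (v : V) :
    (G.induce {v}).Connected :=
  Connected.mk Preconnected.of_subsingleton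

/-- If `house` is not an induced minor of `G`, a vertex attaching to two bags of a `5`-cycle
model attaches to all of them. -/
theorem adj_all_of_adj_two {V : Type} {G : SimpleGraph V} (hG : ¬ InducedMinor house G)
    {X : Fin 5 → Set V} (hX : IsInducedMinorModel G (cycleGraph 5) X) {w : V}
    (hw : ∀ i, w ∉ X i) {i j : Fin 5} (hij : i ≠ j) (hi : ∃ x ∈ X i, G.Adj w x)
    (hj : ∃ x ∈ X j, G.Adj w x) (l : Fin 5) : ∃ x ∈ X l, G.Adj w x := by
  classical
  by_contra hl
  obtain ⟨k, hk⟩ := exists_rotation_eq (fun i => decide (∃ x ∈ X i, G.Adj w x))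
    ⟨i, j, hij, by simpa using hi, by simpa using hj⟩ ⟨l, by simpa using hl⟩
  set N : Fin 5 → Bool := fun i => decide (∃ x ∈ X (i + k), G.Adj w x) with hN
  have hY : IsInducedMinorModel G (partialWheel N)
      (fun o => o.elim {w} (fun i => X (i + k))) := by
    obtain ⟨h1, h2, h3, h4, h5⟩ := hX
    have hrot : ∀ a b : Fin 5, (cycleGraph 5).Adj (a + k) (b + k) ↔ (cycleGraph 5).Adj a b := by
      clear hk hN N
      revert k
      decide
    refine ⟨?_, ?_, ?_, ?_, ?_⟩
    · rintro (_ | a)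
      · exact Set.singleton_nonempty w
      · exact h1 _
    · rintro (_ | a)
      · exact connected_induce_singleton G w
      · exact h2 _
    · rintro (_ | a) (_ | b) hab
      · exact absurd rfl hab
      · exact Set.disjoint_singleton_left.2 (hw _)
      · exact Set.disjoint_singleton_right.2 (hw _)
      · exact h3 fun h => hab (by rw [add_right_cancel h])
    · rintro (_ | a) (_ | b) hab
      · exact hab.elim
      · obtain ⟨x, hx, hwx⟩ := of_decide_eq_true (show N b = true from hab)
        exact ⟨w, rfl, x, hx, hwx⟩
      · obtain ⟨x, hx, hwx⟩ := of_decide_eq_true (show N a = true from hab)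
        exact ⟨x, hx, w, rfl, hwx.symm⟩
      · exact h4 _ _ ((hrot a b).2 hab)
    · rintro (_ | a) (_ | b) hne hab
      · exact absurd rfl hne
      · rintro _ rfl y hy hwy
        exact hab (show N b = true from decide_eq_true ⟨y, hy, hwy⟩)
      · rintro y hy _ rfl hwy
        exact hab (show N a = true from decide_eq_true ⟨y, hy, hwy.symm⟩)
      · exact h5 _ _ (fun h => hne (by rw [add_right_cancel h])) (mt (hrot a b).1 hab)
  apply hG
  rcases hk with hk | hk | hk | hk | hk <;> rw [show N = _ from hk] at hY
  · exact hY.inducedMinor_of_pairs ![some 0, some 4, some 2, some 1, none]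
      ![some 0, some 4, some 3, some 1, none] (by decide) (by decide) (by decide)
  · exact hY.inducedMinor_of_pairs ![some 0, some 4, some 3, some 2, some 1]
      ![none, some 4, some 3, some 2, some 1] (by decide) (by decide) (by decide)
  · exact hY.inducedMinor_of_pairs ![some 0, some 4, some 3, some 1, none]
      ![some 0, some 4, some 3, some 2, none] (by decide) (by decide) (by decide)
  · exact hY.inducedMinor_of_pairs ![none, some 0, some 4, some 3, some 2]
      ![none, some 0, some 4, some 3, some 2] (by decide) (by decide) (by decide)
  · exact hY.inducedMinor_of_pairs ![some 0, some 1, some 2, some 3, some 4]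
      ![some 0, some 1, some 2, none, some 4] (by decide) (by decide) (by decide)

/-! ### Full components of a minimal separator -/

/-- `A` is a full component of `G − S`: it is connected, avoids `S`, has no neighbours outside
`A ∪ S`, and every vertex of `S` has a neighbour in `A`. -/
structure IsFullComponent {V : Type} (G : SimpleGraph V) (S A : Set V) : Prop where
  connected : (G.induce A).Connected
  notMem : ∀ a ∈ A, a ∉ S
  closed : ∀ a ∈ A, ∀ x, G.Adj a x → x ∉ S → x ∈ A
  full : ∀ s ∈ S, ∃ a ∈ A, G.Adj s a

/-- The vertices reachable from `a` by walks avoiding `S`. -/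
def sideOf {V : Type} (G : SimpleGraph V) (S : Set V) (a : V) : Set V :=
  {x | ∃ p : G.Walk a x, ∀ y ∈ p.support, y ∉ S}

theorem self_mem_sideOf {V : Type} {G : SimpleGraph V} {S : Set V} {a : V} (ha : a ∉ S) :
    a ∈ sideOf G S a :=
  ⟨Walk.nil, by simpa using ha⟩

theorem sideOf_closed {V : Type} {G : SimpleGraph V} {S : Set V} {a x y : V}
    (hx : x ∈ sideOf G S a) (hxy : G.Adj x y) (hy : y ∉ S) : y ∈ sideOf G S a := by
  obtain ⟨p, hp⟩ := hx
  refine ⟨p.concat hxy, fun z hz => ?_⟩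
  rw [Walk.support_concat, List.mem_append, List.mem_singleton] at hz
  rcases hz with hz | rfl
  · exact hp z hz
  · exact hy

theorem sideOf_connected {V : Type} {G : SimpleGraph V} {S : Set V} {a : V} (ha : a ∉ S) :
    (G.induce (sideOf G S a)).Connected := by
  classical
  refine G.induce_connected_of_patches a (self_mem_sideOf ha) ?_
  rintro v ⟨p, hp⟩
  refine ⟨{x | x ∈ p.support}, fun x hx => ⟨p.takeUntil x hx, fun y hy =>
    hp y (p.support_takeUntil_subset_support hx hy)⟩, p.start_mem_support, p.end_mem_support, ?_⟩
  exact p.connected_induce_support.preconnected _ _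

/-- A walk leaving a side of `S` and meeting `S` at most in `s` shows that `s` has a neighbour
in that side. -/
theorem exists_adj_of_walk_leaving {V : Type} {G : SimpleGraph V} {S : Set V} {a s : V}
    {x b : V} (p : G.Walk x b) (hx : x ∈ sideOf G S a) (hb : b ∉ sideOf G S a)
    (hp : ∀ y ∈ p.support, y ∉ S \ {s}) : ∃ c ∈ sideOf G S a, G.Adj s c := by
  induction p with
  | nil => exact absurd hx hb
  | @cons x n b h p ih =>
    have hp' : ∀ y ∈ p.support, y ∉ S \ {s} := fun y hy => hp y (by simp [hy])
    by_cases hn : n ∈ S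
    · have : n = s := by
        by_contra hns
        exact hp' n p.start_mem_support ⟨hn, hns⟩
      exact ⟨x, hx, this ▸ h.symm⟩
    · exact ih (sideOf_closed hx h hn) hb hp'

theorem Separates.symm {V : Type} {G : SimpleGraph V} {S : Set V} {a b : V}
    (h : Separates G S a b) : Separates G S b a := fun p => by
  simpa using h p.reverse

theorem isFullComponent_sideOf {V : Type} {G : SimpleGraph V} {S : Set V} {a b : V}
    (ha : a ∉ S) (hsep : Separates G S a b)
    (hmin : ∀ S' : Set V, S' ⊂ S → ¬ Separates G S' a b) :
    IsFullComponent G S (sideOf G S a) where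
  connected := sideOf_connected ha
  notMem := fun x ⟨p, hp⟩ => hp x p.end_mem_support
  closed := fun x hx y hxy hy => sideOf_closed hx hxy hy
  full := fun s hs => by
    have h := hmin (S \ {s}) (Set.sdiff_singleton_ssubset.2 hs)
    unfold Separates at h
    push Not at h
    obtain ⟨p, hp⟩ := h
    refine exists_adj_of_walk_leaving p (self_mem_sideOf ha) ?_ hp
    rintro ⟨q, hq⟩
    obtain ⟨x, hx, hxS⟩ := hsep q
    exact hq x hx hxS

theorem IsMinimalSeparator.exists_isFullComponent {V : Type} {G : SimpleGraph V} {S : Set V}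
    (h : IsMinimalSeparator G S) :
    ∃ A B : Set V, IsFullComponent G S A ∧ IsFullComponent G S B ∧ Disjoint A B := by
  obtain ⟨a, b, ha, hb, -, -, hsep, hmin⟩ := h
  refine ⟨sideOf G S a, sideOf G S b, isFullComponent_sideOf ha hsep hmin,
    isFullComponent_sideOf hb hsep.symm fun S' hS' h => hmin S' hS' h.symm, ?_⟩
  rw [Set.disjoint_left]
  rintro x ⟨p, hp⟩ ⟨q, hq⟩
  obtain ⟨y, hy, hyS⟩ := hsep (p.append q.reverse)
  rw [Walk.mem_support_append_iff, Walk.support_reverse, List.mem_reverse] at hy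
  exact hy.elim (fun h => hp y h hyS) (fun h => hq y h hyS)

/-- A finite connected set with at least two vertices has a vertex whose removal leaves it
connected. -/
theorem exists_connected_induce_diff_singleton {V : Type} [Finite V] {G : SimpleGraph V}
    {D : Set V} (hD : (G.induce D).Connected) (hD2 : D.Nontrivial) :
    ∃ v ∈ D, (G.induce (D \ {v})).Connected := by
  have : Nontrivial D := hD2.coe_sort
  obtain ⟨⟨v, hv⟩, h⟩ := hD.exists_connected_induce_compl_singleton_of_finite_nontrivial
  refine ⟨v, hv, Connected.map (H := G.induce (D \ {v}))
    ⟨fun x => ⟨x.1.1, x.1.2, fun hx => x.2 (Subtype.ext hx)⟩, fun hab => hab⟩ ?_ h⟩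
  rintro ⟨x, hx, hxv⟩
  exact ⟨⟨⟨x, hx⟩, fun hx' => hxv (congrArg Subtype.val hx')⟩, rfl⟩

/-- In a connected induced subgraph with at least two vertices every vertex has a neighbour. -/
theorem exists_adj_mem_diff_singleton {V : Type} {G : SimpleGraph V} {D : Set V} {v : V}
    (hD : (G.induce D).Connected) (hD2 : D.Nontrivial) (hv : v ∈ D) :
    ∃ d ∈ D \ {v}, G.Adj d v := by
  have : Nontrivial D := hD2.coe_sort
  obtain ⟨⟨d, hd⟩, h⟩ := hD.preconnected.exists_adj_of_nontrivial ⟨v, hv⟩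
  have h : G.Adj v d := h
  exact ⟨d, ⟨hd, h.ne'⟩, h.symm⟩

theorem isInducedMinorModel_of_lt {V W : Type} [LinearOrder W] {G : SimpleGraph V}
    {H : SimpleGraph W} {X : W → Set V} (hne : ∀ i, (X i).Nonempty)
    (hconn : ∀ i, (G.induce (X i)).Connected)
    (h : ∀ i j, i < j →
      Disjoint (X i) (X j) ∧ (H.Adj i j ↔ ∃ a ∈ X i, ∃ b ∈ X j, G.Adj a b)) :
    IsInducedMinorModel G H X := by
  refine ⟨hne, hconn, fun i j hij => ?_, fun i j hij => ?_, fun i j hij hn a ha b hb hab => ?_⟩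
  · rcases hij.lt_or_gt with hlt | hlt
    · exact (h i j hlt).1
    · exact (h j i hlt).1.symm
  · rcases hij.ne.lt_or_gt with hlt | hlt
    · exact (h i j hlt).2.1 hij
    · obtain ⟨b, hb, a, ha, hab⟩ := (h j i hlt).2.1 hij.symm
      exact ⟨a, ha, b, hb, hab.symm⟩
  · rcases hij.lt_or_gt with hlt | hlt
    · exact hn ((h i j hlt).2.2 ⟨a, ha, b, hb, hab⟩)
    · exact hn ((h j i hlt).2.2 ⟨b, hb, a, ha, hab.symm⟩).symm

/-- In a graph without `house` as induced minor, a minimal separator with full components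
`A` and `B` is either dominated by a vertex of `A`, or determined by three vertices. -/
theorem dominated_or_eq {V : Type} [Finite V] {G : SimpleGraph V}
    (hG : ¬ InducedMinor house G) {S A B : Set V} (hA : IsFullComponent G S A)
    (hB : IsFullComponent G S B) (hAB : Disjoint A B) :
    (∃ v ∈ A, ∀ s ∈ S, G.Adj s v) ∨
      ∃ y z v, S = {y, z} ∪ (G.neighborSet v ∩ G.neighborSet z) := by
  have hnAB : ∀ a ∈ A, ∀ b ∈ B, ¬ G.Adj a b := fun a ha b hb hab =>
    Set.disjoint_left.1 hAB (hA.closed a ha b hab (hB.notMem b hb)) hb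
  obtain ⟨D, -, ⟨hDA, hDconn, hDfull⟩, hDmin⟩ := exists_minimal_le_of_wellFoundedLT
    (fun D : Set V => D ⊆ A ∧ (G.induce D).Connected ∧ ∀ s ∈ S, ∃ d ∈ D, G.Adj s d) A
    ⟨subset_rfl, hA.connected, hA.full⟩
  rcases D.subsingleton_or_nontrivial with hD1 | hD2
  · obtain ⟨⟨v, hv⟩⟩ := hDconn.nonempty
    refine Or.inl ⟨v, hDA hv, fun s hs => ?_⟩
    obtain ⟨d, hd, hsd⟩ := hDfull s hs
    rwa [hD1 hv hd]
  right
  obtain ⟨v, hv, hD'⟩ := exists_connected_induce_diff_singleton hDconn hD2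
  obtain ⟨d₀, hd₀, hd₀v⟩ := exists_adj_mem_diff_singleton hDconn hD2 hv
  have hsplit : ∀ s ∈ S, (∃ d ∈ D \ {v}, G.Adj s d) ∨ G.Adj s v := by
    intro s hs
    obtain ⟨d, hd, hsd⟩ := hDfull s hs
    by_cases hdv : d = v
    · exact Or.inr (hdv ▸ hsd)
    · exact Or.inl ⟨d, ⟨hd, hdv⟩, hsd⟩
  obtain ⟨y, hyS, hyv⟩ : ∃ y ∈ S, ¬ G.Adj y v := by
    by_contra! h
    exact hd₀.2 (hDmin ⟨Set.singleton_subset_iff.2 (hDA hv), connected_induce_singleton G v,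
      fun s hs => ⟨v, rfl, h s hs⟩⟩ (Set.singleton_subset_iff.2 hv) hd₀.1)
  obtain ⟨z, hzS, hzD⟩ : ∃ z ∈ S, ∀ d ∈ D \ {v}, ¬ G.Adj z d := by
    by_contra! h
    exact (hDmin ⟨Set.sdiff_subset.trans hDA, hD', h⟩ Set.sdiff_subset hv).2 rfl
  have hyD : ∃ d ∈ D \ {v}, G.Adj y d := (hsplit y hyS).resolve_right hyv
  have hzv : G.Adj z v := (hsplit z hzS).resolve_left fun ⟨d, hd, h⟩ => hzD d hd h
  have hyz : y ≠ z := fun h => hyv (h ▸ hzv)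
  have hSA : ∀ s ∈ S, s ∉ A := fun s hs h => hA.notMem s h hs
  have hSB : ∀ s ∈ S, s ∉ B := fun s hs h => hB.notMem s h hs
  have hD'A : D \ {v} ⊆ A := Set.sdiff_subset.trans hDA
  have hmodel : ∀ H : SimpleGraph (Fin 5), H.Adj 0 1 → ¬ H.Adj 0 2 → (H.Adj 0 3 ↔ G.Adj y z) →
      H.Adj 0 4 → H.Adj 1 2 → ¬ H.Adj 1 3 → ¬ H.Adj 1 4 → H.Adj 2 3 → ¬ H.Adj 2 4 →
      H.Adj 3 4 → IsInducedMinorModel G H ![{y}, D \ {v}, {v}, {z}, B] := by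
    intro H h01 h02 h03 h04 h12 h13 h14 h23 h24 h34
    refine isInducedMinorModel_of_lt (fun i => ?_) (fun i => ?_) (fun i j hij => ?_)
    · fin_cases i
      exacts [⟨y, rfl⟩, ⟨d₀, hd₀⟩, ⟨v, rfl⟩, ⟨z, rfl⟩,
        Set.nonempty_coe_sort.1 hB.connected.nonempty]
    · fin_cases i
      exacts [connected_induce_singleton G y, hD', connected_induce_singleton G v,
        connected_induce_singleton G z, hB.connected]
    · have e01 : Disjoint {y} (D \ {v}) :=
        Set.disjoint_singleton_left.2 fun h => hSA y hyS (hD'A h)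
      have e02 : Disjoint {y} {v} :=
        Set.disjoint_singleton.2 fun h => hSA y hyS (h ▸ hDA hv)
      have e04 : Disjoint {y} B := Set.disjoint_singleton_left.2 (hSB y hyS)
      have e12 : Disjoint (D \ {v}) {v} := Set.disjoint_sdiff_left
      have e13 : Disjoint (D \ {v}) {z} :=
        Set.disjoint_singleton_right.2 fun h => hSA z hzS (hD'A h)
      have e24 : Disjoint {v} B :=
        Set.disjoint_singleton_left.2 (Set.disjoint_left.1 hAB (hDA hv))
      have e34 : Disjoint {z} B := Set.disjoint_singleton_left.2 (hSB z hzS)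
      have ne : ∀ {X Y : Set V}, (∀ a ∈ X, ∀ b ∈ Y, ¬ G.Adj a b) →
          ¬ ∃ a ∈ X, ∃ b ∈ Y, G.Adj a b := fun h ⟨a, ha, b, hb, hab⟩ => h a ha b hb hab
      fin_cases i <;> fin_cases j <;> first | exact absurd hij (by decide) | skip
      · exact ⟨e01, iff_of_true h01 ⟨y, rfl, hyD⟩⟩
      · exact ⟨e02, iff_of_false h02 (ne (by rintro _ rfl _ rfl; exact hyv))⟩
      · exact ⟨Set.disjoint_singleton.2 hyz, h03.trans
          ⟨fun h => ⟨y, rfl, z, rfl, h⟩, by rintro ⟨_, rfl, _, rfl, h⟩; exact h⟩⟩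
      · exact ⟨e04, iff_of_true h04 ⟨y, rfl, hB.full y hyS⟩⟩
      · exact ⟨e12, iff_of_true h12 ⟨d₀, hd₀, v, rfl, hd₀v⟩⟩
      · exact ⟨e13, iff_of_false h13
          (ne (by rintro d hd _ rfl h; exact hzD d hd h.symm))⟩
      · exact ⟨hAB.mono_left hD'A, iff_of_false h14 (ne fun a ha => hnAB a (hD'A ha))⟩
      · exact ⟨Set.disjoint_singleton.2 hzv.ne', iff_of_true h23 ⟨v, rfl, z, rfl, hzv.symm⟩⟩
      · exact ⟨e24, iff_of_false h24 (ne (by rintro _ rfl; exact hnAB _ (hDA hv)))⟩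
      · exact ⟨e34, iff_of_true h34 ⟨z, rfl, hB.full z hzS⟩⟩
  have hnyz : ¬ G.Adj y z := fun h => hG ⟨_, hmodel house (by decide) (by decide)
    (iff_of_true (by decide) h) (by decide) (by decide) (by decide) (by decide) (by decide)
    (by decide) (by decide)⟩
  have hC := hmodel (cycleGraph 5) (by decide) (by decide) (iff_of_false (by decide) hnyz)
    (by decide) (by decide) (by decide) (by decide) (by decide) (by decide) (by decide)
  refine ⟨y, z, v, Set.Subset.antisymm (fun s hs => ?_) ?_⟩
  · by_cases hsy : s = y
    · exact Or.inl (Or.inl hsy)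
    by_cases hsz : s = z
    · exact Or.inl (Or.inr hsz)
    have hout : ∀ i, s ∉ (![{y}, D \ {v}, {v}, {z}, B] : Fin 5 → Set V) i := by
      intro i
      fin_cases i
      exacts [hsy, fun h => hSA s hs (hD'A h), fun h => hSA s hs (h ▸ hDA hv), hsz, hSB s hs]
    have hall := fun l : Fin 5 => (hsplit s hs).elim
      (fun h => adj_all_of_adj_two hG hC hout (show (4 : Fin 5) ≠ 1 by decide)
        (hB.full s hs) h l)
      (fun h => adj_all_of_adj_two hG hC hout (show (4 : Fin 5) ≠ 2 by decide)
        (hB.full s hs) ⟨v, rfl, h⟩ l)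
    obtain ⟨_, rfl, h2⟩ := hall 2
    obtain ⟨_, rfl, h3⟩ := hall 3
    exact Or.inr ⟨h2.symm, h3.symm⟩
  · rintro s ((rfl | rfl) | ⟨hvs, hzs⟩)
    · exact hyS
    · exact hzS
    · by_contra hs
      have hsA : s ∈ A := hA.closed v (hDA hv) s hvs hs
      have hout : ∀ i, s ∉ (![{y}, D \ {v}, {v}, {z}, B] : Fin 5 → Set V) i := by
        intro i
        fin_cases i
        exacts [fun h => hs (h ▸ hyS), fun h => hzD s h hzs, fun h => G.ne_of_adj hvs h.symm,
          fun h => hs (h ▸ hzS), Set.disjoint_left.1 hAB hsA]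
      obtain ⟨b, hb, hsb⟩ := adj_all_of_adj_two hG hC hout (show (2 : Fin 5) ≠ 3 by decide)
        ⟨v, rfl, hvs.symm⟩ ⟨z, rfl, hzs.symm⟩ 4
      exact hnAB s hsA b hb hsb

/-- Every minimal separator of a graph without `house` as induced minor is determined by
two or three vertices. -/
theorem IsMinimalSeparator.eq_of_house_free {V : Type} [Finite V] {G : SimpleGraph V}
    (hG : ¬ InducedMinor house G) {S : Set V} (hS : IsMinimalSeparator G S) :
    (∃ u v, S = G.neighborSet u ∩ G.neighborSet v) ∨
      ∃ y z v, S = {y, z} ∪ (G.neighborSet v ∩ G.neighborSet z) := by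
  obtain ⟨A, B, hA, hB, hAB⟩ := hS.exists_isFullComponent
  rcases dominated_or_eq hG hA hB hAB with ⟨u, hu, huS⟩ | h
  · rcases dominated_or_eq hG hB hA hAB.symm with ⟨v, hv, hvS⟩ | h
    · refine Or.inl ⟨u, v, Set.Subset.antisymm
        (fun s hs => ⟨(huS s hs).symm, (hvS s hs).symm⟩) ?_⟩
      rintro s ⟨hus, hvs⟩
      by_contra hs
      exact Set.disjoint_left.1 hAB (hA.closed u hu s hus hs) (hB.closed v hv s hvs hs)
    · exact Or.inr h
  · exact Or.inr h

theorem house_induced_minor_free_tame :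
    Tame (fun n (G : SimpleGraph (Fin n)) => ¬ InducedMinor house G) := by
  refine ⟨Polynomial.X ^ 2 + Polynomial.X ^ 3, fun n G hG => ?_⟩
  let f : Fin n × Fin n → Set (Fin n) := fun t => G.neighborSet t.1 ∩ G.neighborSet t.2
  let g : Fin n × Fin n × Fin n → Set (Fin n) := fun t =>
    {t.1, t.2.1} ∪ (G.neighborSet t.2.2 ∩ G.neighborSet t.2.1)
  have hsub : {S | IsMinimalSeparator G S} ⊆ Set.range f ∪ Set.range g := by
    intro S hS
    rcases hS.eq_of_house_free hG with ⟨u, v, h⟩ | ⟨y, z, v, h⟩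
    · exact Or.inl ⟨(u, v), h.symm⟩
    · exact Or.inr ⟨(y, z, v), h.symm⟩
  have hf : (Set.range f).ncard ≤ n ^ 2 := by
    rw [← Set.image_univ]
    refine (Set.ncard_image_le).trans_eq ?_
    simp [Set.ncard_univ, sq]
  have hg : (Set.range g).ncard ≤ n ^ 3 := by
    rw [← Set.image_univ]
    refine (Set.ncard_image_le).trans_eq ?_
    simp [Set.ncard_univ, pow_succ, mul_assoc]
  calc numMinSep G ≤ (Set.range f ∪ Set.range g).ncard := Set.ncard_le_ncard hsub
    _ ≤ (Set.range f).ncard + (Set.range g).ncard := Set.ncard_union_le _ _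
    _ ≤ n ^ 2 + n ^ 3 := Nat.add_le_add hf hg
    _ = _ := by simp
end

section
/- Let H be a finite simple graph that is an induced minor of the k-prism for some integer k ≥ 3 and also an induced minor of the ℓ-theta for some integer ℓ ≥ 3. Then H is isomorphic to an induced subgraph of the diamond, the butterfly, or the house. -/
open SimpleGraph

/-! ### Structure of induced minors of prisms -/

/-- The vertices of an induced minor of a prism can be covered by two cliques. -/
theorem InducedMinor.exists_clique_cover_of_prismGraph {W : Type} {H : SimpleGraph W} {k : ℕ}
    (h : InducedMinor H (prismGraph k)) :
    ∃ P : W → Prop, (∀ u w, u ≠ w → P u → P w → H.Adj u w) ∧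
      (∀ u w, u ≠ w → ¬ P u → ¬ P w → H.Adj u w) := by
  obtain ⟨X, hne, -, hdisj, -, hnadj⟩ := h
  have key : ∀ (e : Fin 2) (u w : W), u ≠ w → (∃ i, (i, e) ∈ X u) → (∃ i, (i, e) ∈ X w) →
      H.Adj u w := by
    rintro e u w huw ⟨i, hi⟩ ⟨j, hj⟩
    by_contra hadj
    have hij : i ≠ j := by
      rintro rfl
      exact Set.disjoint_left.1 (hdisj huw) hi hj
    exact hnadj u w huw hadj _ hi _ hj (by simp [prismGraph, hij])
  have hone : ∀ w, (¬ ∃ i, (i, (0 : Fin 2)) ∈ X w) → ∃ i, (i, (1 : Fin 2)) ∈ X w := by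
    intro w hw
    obtain ⟨⟨i, e⟩, hi⟩ := hne w
    fin_cases e
    · exact absurd ⟨i, hi⟩ hw
    · exact ⟨i, hi⟩
  exact ⟨fun w => ∃ i, (i, (0 : Fin 2)) ∈ X w, key 0,
    fun u w huw hu hw => key 1 u w huw (hone u hu) (hone w hw)⟩

/-! ### Structure of induced minors of thetas -/

/-- The combinatorial trace left on `H` by an induced minor model in a theta: `α` and `β` mark
the vertices whose branch sets contain the two vertices of large degree. -/
structure ThetaMarking {W : Type} (H : SimpleGraph W) (α β : W → Prop) : Prop where
  eq_of_left : ∀ u w, α u → α w → u = w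
  eq_of_right : ∀ u w, β u → β w → u = w
  eq_of_adj : ∀ s t t', ¬ α s → ¬ β s → ¬ α t → ¬ β t → ¬ α t' → ¬ β t' →
    H.Adj s t → H.Adj s t' → t = t'
  marked_of_adj : ∀ s t w, ¬ α s → ¬ β s → ¬ α t → ¬ β t →
    H.Adj s t → H.Adj w s → H.Adj w t → α w ∧ β w
  adj_or_adj : ∀ s u w, ¬ α s → ¬ β s → α u → β w → H.Adj s u ∨ H.Adj s w

/-- A function that is constant along the edges inside a connected set is constant on it. -/
theorem SimpleGraph.Connected.apply_eq_of_induce {V ι : Type*} {G : SimpleGraph V} {S : Set V}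
    (hS : (G.induce S).Connected) (f : V → ι)
    (hf : ∀ u ∈ S, ∀ v ∈ S, G.Adj u v → f u = f v) {u v : V} (hu : u ∈ S) (hv : v ∈ S) :
    f u = f v := by
  have aux : ∀ x y : S, (G.induce S).Walk x y → f x = f y := by
    intro x y p
    induction p with
    | nil => rfl
    | cons h _ ih => exact (hf _ (Subtype.prop _) _ (Subtype.prop _) h).trans ih
  obtain ⟨p⟩ := hS.preconnected ⟨u, hu⟩ ⟨v, hv⟩
  exact aux _ _ p

/-- A connected set of vertices of a theta avoiding both vertices of large degree lies in a
single path. -/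
theorem exists_path_of_connected_induce_thetaGraph {k : ℕ} {S : Set (Fin 2 ⊕ Fin k × Fin 2)}
    (hne : S.Nonempty) (hS : ((thetaGraph k).induce S).Connected)
    (h0 : Sum.inl 0 ∉ S) (h1 : Sum.inl 1 ∉ S) :
    ∃ i, ∀ v ∈ S, v = Sum.inr (i, 0) ∨ v = Sum.inr (i, 1) := by
  have hl : ∀ x : Fin 2, Sum.inl x ∉ S := by
    intro x
    fin_cases x
    · exact h0
    · exact h1
  obtain ⟨v₀ | ⟨i, e⟩, hv₀⟩ := hne
  · exact absurd hv₀ (hl v₀)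
  refine ⟨i, ?_⟩
  rintro (x | ⟨j, e'⟩) hv
  · exact absurd hv (hl x)
  have hij := hS.apply_eq_of_induce
    (Sum.elim (fun _ => none) (fun p : Fin k × Fin 2 => some p.1)) (by
      rintro (x | ⟨x, e₁⟩) hx (y | ⟨y, e₂⟩) hy hadj
      · exact absurd hx (hl x)
      · exact absurd hx (hl x)
      · exact absurd hy (hl y)
      · simp only [thetaGraph, fromRel_adj] at hadj
        simp at hadj ⊢
        grind) hv₀ hv
  simp only [Sum.elim_inr, Option.some.injEq] at hij
  subst hij
  fin_cases e' <;> simp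

theorem thetaGraph_adj_zero {k : ℕ} {i : Fin k} {v : Fin 2 ⊕ Fin k × Fin 2} :
    (thetaGraph k).Adj v (Sum.inr (i, 0)) ↔ v = Sum.inl 0 ∨ v = Sum.inr (i, 1) := by
  rcases v with x | ⟨j, e⟩
  · simp [thetaGraph]
  · simp [thetaGraph]
    grind

theorem thetaGraph_adj_one {k : ℕ} {i : Fin k} {v : Fin 2 ⊕ Fin k × Fin 2} :
    (thetaGraph k).Adj v (Sum.inr (i, 1)) ↔ v = Sum.inl 1 ∨ v = Sum.inr (i, 0) := by
  rcases v with x | ⟨j, e⟩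
  · simp [thetaGraph]
  · simp [thetaGraph]
    grind

theorem InducedMinor.exists_thetaMarking {W : Type} {H : SimpleGraph W} {k : ℕ}
    (h : InducedMinor H (thetaGraph k)) : ∃ α β : W → Prop, ThetaMarking H α β := by
  obtain ⟨X, hne, hconn, hdisj, hadj, hnadj⟩ := h
  have heq : ∀ v u w, v ∈ X u → v ∈ X w → u = w := by
    intro v u w hu hw
    by_contra huw
    exact Set.disjoint_left.1 (hdisj huw) hu hw
  have hpath : ∀ w, Sum.inl 0 ∉ X w → Sum.inl 1 ∉ X w →
      ∃ i, ∀ v ∈ X w, v = Sum.inr (i, 0) ∨ v = Sum.inr (i, 1) := fun w =>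
    exists_path_of_connected_induce_thetaGraph (hne w) (hconn w)
  have hedge : ∀ s t, Sum.inl 0 ∉ X s → Sum.inl 1 ∉ X s → Sum.inl 0 ∉ X t → Sum.inl 1 ∉ X t →
      H.Adj s t → ∃ i, (X s = {Sum.inr (i, 0)} ∧ X t = {Sum.inr (i, 1)}) ∨
        (X s = {Sum.inr (i, 1)} ∧ X t = {Sum.inr (i, 0)}) := by
    intro s t hs0 hs1 ht0 ht1 hst
    obtain ⟨i, hi⟩ := hpath s hs0 hs1
    obtain ⟨j, hj⟩ := hpath t ht0 ht1
    obtain ⟨a, ha, b, hb, hab⟩ := hadj s t hst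
    refine ⟨i, ?_⟩
    rcases hj b hb with rfl | rfl
    · rcases thetaGraph_adj_zero.1 hab with rfl | rfl
      · exact absurd ha hs0
      · have hij : i = j := by simpa [eq_comm] using hi _ ha
        subst hij
        right
        constructor <;> ext v <;> rw [Set.mem_singleton_iff] <;> grind [hst.ne]
    · rcases thetaGraph_adj_one.1 hab with rfl | rfl
      · exact absurd ha hs1
      · have hij : i = j := by simpa [eq_comm] using hi _ ha
        subst hij
        left
        constructor <;> ext v <;> rw [Set.mem_singleton_iff] <;> grind [hst.ne]
  refine ⟨fun w => Sum.inl 0 ∈ X w, fun w => Sum.inl 1 ∈ X w, heq _, heq _, ?_, ?_, ?_⟩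
  · intro s t t' hs0 hs1 ht0 ht1 ht'0 ht'1 hst hst'
    obtain ⟨i, hi⟩ := hedge s t hs0 hs1 ht0 ht1 hst
    obtain ⟨j, hj⟩ := hedge s t' hs0 hs1 ht'0 ht'1 hst'
    obtain ⟨v, hv⟩ := hne t
    refine heq v t t' hv ?_
    clear hedge hpath hnadj hadj hdisj hconn heq
    rcases hi with ⟨hi, hi'⟩ | ⟨hi, hi'⟩ <;> rcases hj with ⟨hj, hj'⟩ | ⟨hj, hj'⟩ <;>
      simp_all
  · intro s t w hs0 hs1 ht0 ht1 hst hws hwt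
    obtain ⟨a, ha, b, hb, hab⟩ := hadj w s hws
    obtain ⟨a', ha', b', hb', hab'⟩ := hadj w t hwt
    obtain ⟨i, ⟨hi, hi'⟩ | ⟨hi, hi'⟩⟩ := hedge s t hs0 hs1 ht0 ht1 hst
    · rw [hi, Set.mem_singleton_iff] at hb
      rw [hi', Set.mem_singleton_iff] at hb'
      subst hb hb'
      rw [thetaGraph_adj_zero] at hab
      rw [thetaGraph_adj_one] at hab'
      have h1 : Sum.inr (i, 1) ∉ X w := fun h => hwt.ne (heq _ _ _ h (by simp [hi']))
      have h0 : Sum.inr (i, 0) ∉ X w := fun h => hws.ne (heq _ _ _ h (by simp [hi]))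
      grind
    · rw [hi, Set.mem_singleton_iff] at hb
      rw [hi', Set.mem_singleton_iff] at hb'
      subst hb hb'
      rw [thetaGraph_adj_one] at hab
      rw [thetaGraph_adj_zero] at hab'
      have h1 : Sum.inr (i, 1) ∉ X w := fun h => hws.ne (heq _ _ _ h (by simp [hi]))
      have h0 : Sum.inr (i, 0) ∉ X w := fun h => hwt.ne (heq _ _ _ h (by simp [hi']))
      grind
  · intro s w w' hs0 hs1 hw hw'
    obtain ⟨i, hi⟩ := hpath s hs0 hs1
    obtain ⟨v, hv⟩ := hne s
    by_contra! hcon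
    rcases hi v hv with rfl | rfl
    · exact hnadj s w (fun h => hs0 (h ▸ hw)) hcon.1 _ hv _ hw
        (thetaGraph_adj_zero.2 (by simp)).symm
    · exact hnadj s w' (fun h => hs1 (h ▸ hw')) hcon.2 _ hv _ hw'
        (thetaGraph_adj_one.2 (by simp)).symm

namespace ThetaMarking

variable {W : Type} {H : SimpleGraph W} {α β : W → Prop}

/-- Every triangle contains both marks. -/
theorem marked_of_triangle (hM : ThetaMarking H α β) {x y z : W} (hxy : H.Adj x y)
    (hxz : H.Adj x z) (hyz : H.Adj y z) : (α x ∨ α y ∨ α z) ∧ (β x ∨ β y ∨ β z) := by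
  have h1 := hM.marked_of_adj x y z
  have h2 := hM.marked_of_adj x z y
  have h3 := hM.marked_of_adj y z x
  have h4 := hM.eq_of_left
  have h5 := hM.eq_of_right
  grind +splitImp [hxy.symm, hxz.symm, hyz.symm, hxy.ne, hxz.ne, hyz.ne]

/-- No induced minor of a theta contains a clique on four vertices. -/
theorem false_of_clique (hM : ThetaMarking H α β) {x y z u : W} (hxy : H.Adj x y)
    (hxz : H.Adj x z) (hyz : H.Adj y z) (hxu : H.Adj x u) (hyu : H.Adj y u) (hzu : H.Adj z u) :
    False := by
  have h1 := hM.marked_of_triangle hxy hxz hyz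
  have h2 := hM.marked_of_triangle hxy hxu hyu
  have h3 := hM.marked_of_triangle hxz hxu hzu
  have h4 := hM.marked_of_triangle hyz hyu hzu
  have h5 := hM.eq_of_left
  have h6 := hM.eq_of_right
  grind [hxy.ne, hxz.ne, hyz.ne, hxu.ne, hyu.ne, hzu.ne]

/-- No induced minor of a theta contains two disjoint triangles. -/
theorem false_of_disjoint_triangles (hM : ThetaMarking H α β) {x y z u v w : W}
    (hxy : H.Adj x y) (hxz : H.Adj x z) (hyz : H.Adj y z) (huv : H.Adj u v) (huw : H.Adj u w)
    (hvw : H.Adj v w) (hx : x ≠ u ∧ x ≠ v ∧ x ≠ w) (hy : y ≠ u ∧ y ≠ v ∧ y ≠ w)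
    (hz : z ≠ u ∧ z ≠ v ∧ z ≠ w) : False := by
  have h1 := (hM.marked_of_triangle hxy hxz hyz).1
  have h2 := (hM.marked_of_triangle huv huw hvw).1
  have h3 := hM.eq_of_left
  grind

/-- In an induced minor of a theta, every triangle is dominating. -/
theorem adj_of_triangle (hM : ThetaMarking H α β) {x y z u : W} (hxy : H.Adj x y)
    (hxz : H.Adj x z) (hyz : H.Adj y z) (hx : u ≠ x) (hy : u ≠ y) (hz : u ≠ z) :
    H.Adj u x ∨ H.Adj u y ∨ H.Adj u z := by
  obtain ⟨h1, h2⟩ := hM.marked_of_triangle hxy hxz hyz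
  have h3 := hM.eq_of_left u
  have h4 := hM.eq_of_right u
  have h5 := hM.adj_or_adj u
  grind

/-- In an induced minor of a theta, an edge disjoint from a triangle has no endpoint with two
neighbours in the triangle. -/
theorem not_adj_of_triangle_of_edge (hM : ThetaMarking H α β) {x y z u v : W} (hxy : H.Adj x y)
    (hxz : H.Adj x z) (hyz : H.Adj y z) (huv : H.Adj u v) (hu : u ≠ x ∧ u ≠ y ∧ u ≠ z)
    (hv : v ≠ x ∧ v ≠ y ∧ v ≠ z) (hux : H.Adj u x) : ¬ H.Adj u y := by
  intro huy
  have h1 := hM.marked_of_triangle hxy hxz hyz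
  have h2 := hM.marked_of_triangle hxy hux.symm huy.symm
  have h3 := hM.eq_of_left
  have h4 := hM.eq_of_right
  have hsmall : ∀ w, w ≠ x → w ≠ y → ¬ α w ∧ ¬ β w := by
    have hα : α x ∨ α y := by grind
    have hβ : β x ∨ β y := by grind
    intro w hwx hwy
    exact ⟨fun hw => by grind, fun hw => by grind⟩
  obtain ⟨huα, huβ⟩ := hsmall u hu.1 hu.2.1
  obtain ⟨hvα, hvβ⟩ := hsmall v hv.1 hv.2.1
  obtain ⟨hzα, hzβ⟩ := hsmall z hxz.ne' hyz.ne'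
  rcases hM.adj_of_triangle hxy hxz hyz hv.1 hv.2.1 hv.2.2 with h | h | h
  · have hx := hM.marked_of_adj u v x huα huβ hvα hvβ huv hux.symm h.symm
    have hyα : ¬ α y := fun hy => hxy.ne (h3 _ _ hx.1 hy)
    have hyβ : ¬ β y := fun hy => hxy.ne (h4 _ _ hx.2 hy)
    exact hv.2.1 (hM.eq_of_adj u v y huα huβ hvα hvβ hyα hyβ huv huy)
  · have hy := hM.marked_of_adj u v y huα huβ hvα hvβ huv huy.symm h.symm
    have hxα : ¬ α x := fun hx => hxy.ne (h3 _ _ hx hy.1)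
    have hxβ : ¬ β x := fun hx => hxy.ne (h4 _ _ hx hy.2)
    exact hv.1 (hM.eq_of_adj u v x huα huβ hvα hvβ hxα hxβ huv hux)
  · exact hu.2.2 (hM.eq_of_adj v u z hvα hvβ huα huβ hzα hzβ huv.symm h)

end ThetaMarking

/-! ### Embeddings of small graphs -/

theorem nonempty_embedding_of_enumeration {W : Type} {H : SimpleGraph W} {m n : ℕ}
    {T : SimpleGraph (Fin m)} (g : Fin n → W) (hg : Function.Surjective g) (f : Fin n → Fin m)
    (hf : Function.Injective f)
    (h : ∀ i j, i < j → (H.Adj (g i) (g j) ↔ T.Adj (f i) (f j))) : Nonempty (H ↪g T) := by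
  obtain ⟨s, hs⟩ := hg.hasRightInverse
  refine ⟨⟨⟨f ∘ s, hf.comp hs.injective⟩, ?_⟩⟩
  intro u w
  change T.Adj (f (s u)) (f (s w)) ↔ H.Adj u w
  rcases lt_trichotomy (s u) (s w) with hlt | heq | hlt
  · rw [← h _ _ hlt, hs, hs]
  · simp [hs.injective heq]
  · rw [T.adj_comm, H.adj_comm, ← h _ _ hlt, hs, hs]

section Shapes

variable {W : Type} {H : SimpleGraph W} {a b c d e : W}

theorem nonempty_embedding_diamond (hW : ∀ w, w = a ∨ w = b ∨ w = c ∨ w = d) (hab : H.Adj a b)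
    (hac : H.Adj a c) (hbc : H.Adj b c) (hbd : H.Adj b d) (hcd : H.Adj c d)
    (had : ¬ H.Adj a d) : Nonempty (H ↪g diamond) := by
  refine nonempty_embedding_of_enumeration ![a, b, c, d] ?_ ![0, 1, 2, 3] (by decide) ?_
  · intro w
    simpa [Fin.exists_fin_succ, eq_comm] using hW w
  · simp [Fin.forall_fin_succ, diamond, *]

theorem nonempty_embedding_butterfly_of_paw (hW : ∀ w, w = a ∨ w = b ∨ w = c ∨ w = d)
    (hab : H.Adj a b) (hac : H.Adj a c) (hbc : H.Adj b c) (had : H.Adj a d)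
    (hbd : ¬ H.Adj b d) (hcd : ¬ H.Adj c d) : Nonempty (H ↪g butterfly) := by
  refine nonempty_embedding_of_enumeration ![a, b, c, d] ?_ ![0, 1, 2, 3] (by decide) ?_
  · intro w
    simpa [Fin.exists_fin_succ, eq_comm] using hW w
  · simp [Fin.forall_fin_succ, butterfly, *]

theorem nonempty_embedding_house_of_path (hW : ∀ w, w = a ∨ w = b ∨ w = c ∨ w = d)
    (hab : H.Adj a b) (hbc : H.Adj b c) (hcd : H.Adj c d) (hac : ¬ H.Adj a c)
    (had : ¬ H.Adj a d) (hbd : ¬ H.Adj b d) : Nonempty (H ↪g house) := by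
  refine nonempty_embedding_of_enumeration ![a, b, c, d] ?_ ![1, 2, 3, 4] (by decide) ?_
  · intro w
    simpa [Fin.exists_fin_succ, eq_comm] using hW w
  · simp [Fin.forall_fin_succ, house, *]

theorem nonempty_embedding_house_of_square (hW : ∀ w, w = a ∨ w = b ∨ w = c ∨ w = d)
    (hab : H.Adj a b) (hbc : H.Adj b c) (hcd : H.Adj c d) (had : H.Adj a d)
    (hac : ¬ H.Adj a c) (hbd : ¬ H.Adj b d) : Nonempty (H ↪g house) := by
  refine nonempty_embedding_of_enumeration ![a, b, c, d] ?_ ![0, 1, 2, 3] (by decide) ?_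
  · intro w
    simpa [Fin.exists_fin_succ, eq_comm] using hW w
  · simp [Fin.forall_fin_succ, house, *]

theorem nonempty_embedding_butterfly_of_two_edges (hW : ∀ w, w = a ∨ w = b ∨ w = c ∨ w = d)
    (hab : H.Adj a b) (hcd : H.Adj c d) (hac : ¬ H.Adj a c) (had : ¬ H.Adj a d)
    (hbc : ¬ H.Adj b c) (hbd : ¬ H.Adj b d) : Nonempty (H ↪g butterfly) := by
  refine nonempty_embedding_of_enumeration ![a, b, c, d] ?_ ![1, 2, 3, 4] (by decide) ?_
  · intro w
    simpa [Fin.exists_fin_succ, eq_comm] using hW w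
  · simp [Fin.forall_fin_succ, butterfly, *]

theorem nonempty_embedding_butterfly (hW : ∀ w, w = a ∨ w = b ∨ w = c ∨ w = d ∨ w = e)
    (hab : H.Adj a b) (hac : H.Adj a c) (hbc : H.Adj b c) (had : H.Adj a d) (hae : H.Adj a e)
    (hde : H.Adj d e) (hbd : ¬ H.Adj b d) (hbe : ¬ H.Adj b e) (hcd : ¬ H.Adj c d)
    (hce : ¬ H.Adj c e) : Nonempty (H ↪g butterfly) := by
  refine nonempty_embedding_of_enumeration ![a, b, c, d, e] ?_ ![0, 1, 2, 3, 4] (by decide) ?_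
  · intro w
    simpa [Fin.exists_fin_succ, eq_comm] using hW w
  · simp [Fin.forall_fin_succ, butterfly, *]

theorem nonempty_embedding_house (hW : ∀ w, w = a ∨ w = b ∨ w = c ∨ w = d ∨ w = e)
    (hab : H.Adj a b) (hbc : H.Adj b c) (hcd : H.Adj c d) (hde : H.Adj d e) (hae : H.Adj a e)
    (had : H.Adj a d) (hac : ¬ H.Adj a c) (hbd : ¬ H.Adj b d) (hbe : ¬ H.Adj b e)
    (hce : ¬ H.Adj c e) : Nonempty (H ↪g house) := by
  refine nonempty_embedding_of_enumeration ![a, b, c, d, e] ?_ ![0, 1, 2, 3, 4] (by decide) ?_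
  · intro w
    simpa [Fin.exists_fin_succ, eq_comm] using hW w
  · simp [Fin.forall_fin_succ, house, *]

theorem nonempty_embedding_butterfly_of_triangle (hW : ∀ w, w = a ∨ w = b ∨ w = c)
    (hab : H.Adj a b) (hac : H.Adj a c) (hbc : H.Adj b c) : Nonempty (H ↪g butterfly) := by
  refine nonempty_embedding_of_enumeration ![a, b, c] ?_ ![0, 1, 2] (by decide) ?_
  · intro w
    simpa [Fin.exists_fin_succ, eq_comm] using hW w
  · simp [Fin.forall_fin_succ, butterfly, *]

theorem nonempty_embedding_butterfly_of_cherry (hW : ∀ w, w = a ∨ w = b ∨ w = c)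
    (hab : H.Adj a b) (hac : H.Adj a c) (hbc : ¬ H.Adj b c) : Nonempty (H ↪g butterfly) := by
  refine nonempty_embedding_of_enumeration ![a, b, c] ?_ ![0, 1, 3] (by decide) ?_
  · intro w
    simpa [Fin.exists_fin_succ, eq_comm] using hW w
  · simp [Fin.forall_fin_succ, butterfly, *]

theorem nonempty_embedding_butterfly_of_edge_add_vertex (hW : ∀ w, w = a ∨ w = b ∨ w = c)
    (hab : H.Adj a b) (hac : ¬ H.Adj a c) (hbc : ¬ H.Adj b c) : Nonempty (H ↪g butterfly) := by
  refine nonempty_embedding_of_enumeration ![a, b, c] ?_ ![1, 2, 3] (by decide) ?_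
  · intro w
    simpa [Fin.exists_fin_succ, eq_comm] using hW w
  · simp [Fin.forall_fin_succ, butterfly, *]

theorem nonempty_embedding_butterfly_of_pair (hW : ∀ w, w = a ∨ w = b) :
    Nonempty (H ↪g butterfly) := by
  by_cases hab : H.Adj a b
  · refine nonempty_embedding_of_enumeration ![a, b] ?_ ![0, 1] (by decide) ?_
    · intro w
      simpa [Fin.exists_fin_succ, eq_comm] using hW w
    · simp [Fin.forall_fin_succ, butterfly, *]
  · refine nonempty_embedding_of_enumeration ![a, b] ?_ ![1, 3] (by decide) ?_
    · intro w
      simpa [Fin.exists_fin_succ, eq_comm] using hW w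
    · simp [Fin.forall_fin_succ, butterfly, *]

end Shapes

/-! ### Classification by sizes of the two cliques -/

namespace ThetaMarking

variable {W : Type} {H : SimpleGraph W} {α β : W → Prop} {x y z u v : W}

theorem nonempty_embedding_of_triangle_add_vertex (hM : ThetaMarking H α β)
    (hW : ∀ w, w = x ∨ w = y ∨ w = z ∨ w = u) (hxy : H.Adj x y) (hxz : H.Adj x z)
    (hyz : H.Adj y z) (hx : u ≠ x) (hy : u ≠ y) (hz : u ≠ z) :
    Nonempty (H ↪g diamond) ∨ Nonempty (H ↪g butterfly) := by
  have hdom := hM.adj_of_triangle hxy hxz hyz hx hy hz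
  by_cases hux : H.Adj u x <;> by_cases huy : H.Adj u y <;> by_cases huz : H.Adj u z
  · exact (hM.false_of_clique hxy hxz hyz hux.symm huy.symm huz.symm).elim
  · exact Or.inl (nonempty_embedding_diamond (a := z) (b := x) (c := y) (d := u)
      (fun w => by grind [hW w]) hxz.symm hyz.symm hxy hux.symm huy.symm (mt Adj.symm huz))
  · exact Or.inl (nonempty_embedding_diamond (a := y) (b := x) (c := z) (d := u)
      (fun w => by grind [hW w]) hxy.symm hyz hxz hux.symm huz.symm (mt Adj.symm huy))
  · exact Or.inr (nonempty_embedding_butterfly_of_paw (a := x) (b := y) (c := z) (d := u) hW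
      hxy hxz hyz hux.symm (mt Adj.symm huy) (mt Adj.symm huz))
  · exact Or.inl (nonempty_embedding_diamond (a := x) (b := y) (c := z) (d := u) hW
      hxy hxz hyz huy.symm huz.symm (mt Adj.symm hux))
  · exact Or.inr (nonempty_embedding_butterfly_of_paw (a := y) (b := x) (c := z) (d := u)
      (fun w => by grind [hW w]) hxy.symm hyz hxz huy.symm (mt Adj.symm hux) (mt Adj.symm huz))
  · exact Or.inr (nonempty_embedding_butterfly_of_paw (a := z) (b := x) (c := y) (d := u)
      (fun w => by grind [hW w]) hxz.symm hyz.symm hxy huz.symm (mt Adj.symm hux) (mt Adj.symm huy))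
  · simp_all

theorem nonempty_embedding_of_triangle_add_edge (hM : ThetaMarking H α β)
    (hW : ∀ w, w = x ∨ w = y ∨ w = z ∨ w = u ∨ w = v) (hxy : H.Adj x y) (hxz : H.Adj x z)
    (hyz : H.Adj y z) (huv : H.Adj u v) (hu : u ≠ x ∧ u ≠ y ∧ u ≠ z)
    (hv : v ≠ x ∧ v ≠ y ∧ v ≠ z) :
    Nonempty (H ↪g butterfly) ∨ Nonempty (H ↪g house) := by
  have unique : ∀ p q, H.Adj p q → p ≠ x ∧ p ≠ y ∧ p ≠ z → q ≠ x ∧ q ≠ y ∧ q ≠ z →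
      (H.Adj x p ∧ ¬ H.Adj y p ∧ ¬ H.Adj z p) ∨ (¬ H.Adj x p ∧ H.Adj y p ∧ ¬ H.Adj z p) ∨
        (¬ H.Adj x p ∧ ¬ H.Adj y p ∧ H.Adj z p) := by
    intro p q hpq hp hq
    have h0 := hM.adj_of_triangle hxy hxz hyz hp.1 hp.2.1 hp.2.2
    have h1 := hM.not_adj_of_triangle_of_edge hxy hxz hyz hpq hp hq
    have h2 := hM.not_adj_of_triangle_of_edge hxz hxy hyz.symm hpq (by grind) (by grind)
    have h3 := hM.not_adj_of_triangle_of_edge hyz hxy.symm hxz.symm hpq (by grind) (by grind)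
    rw [H.adj_comm x, H.adj_comm y, H.adj_comm z]
    tauto
  rcases unique u v huv hu hv with ⟨hux, huy, huz⟩ | ⟨hux, huy, huz⟩ | ⟨hux, huy, huz⟩ <;>
    rcases unique v u huv.symm hv hu with ⟨hvx, hvy, hvz⟩ | ⟨hvx, hvy, hvz⟩ | ⟨hvx, hvy, hvz⟩
  · exact Or.inl (nonempty_embedding_butterfly (a := x) (b := y) (c := z) (d := u) (e := v)
      hW hxy hxz hyz hux hvx huv huy hvy huz hvz)
  · exact Or.inr (nonempty_embedding_house (a := x) (b := u) (c := v) (d := y) (e := z)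
      (fun w => by grind [hW w]) hux huv hvy.symm hyz hxz hxy hvx (mt Adj.symm huy)
      (mt Adj.symm huz) (mt Adj.symm hvz))
  · exact Or.inr (nonempty_embedding_house (a := x) (b := u) (c := v) (d := z) (e := y)
      (fun w => by grind [hW w]) hux huv hvz.symm hyz.symm hxy hxz hvx (mt Adj.symm huz)
      (mt Adj.symm huy) (mt Adj.symm hvy))
  · exact Or.inr (nonempty_embedding_house (a := y) (b := u) (c := v) (d := x) (e := z)
      (fun w => by grind [hW w]) huy huv hvx.symm hxz hyz hxy.symm hvy (mt Adj.symm hux)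
      (mt Adj.symm huz) (mt Adj.symm hvz))
  · exact Or.inl (nonempty_embedding_butterfly (a := y) (b := x) (c := z) (d := u) (e := v)
      (fun w => by grind [hW w]) hxy.symm hyz hxz huy hvy huv hux hvx huz hvz)
  · exact Or.inr (nonempty_embedding_house (a := y) (b := u) (c := v) (d := z) (e := x)
      (fun w => by grind [hW w]) huy huv hvz.symm hxz.symm hxy.symm hyz hvy (mt Adj.symm huz)
      (mt Adj.symm hux) (mt Adj.symm hvx))
  · exact Or.inr (nonempty_embedding_house (a := z) (b := u) (c := v) (d := x) (e := y)
      (fun w => by grind [hW w]) huz huv hvx.symm hxy hyz.symm hxz.symm hvz (mt Adj.symm hux)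
      (mt Adj.symm huy) (mt Adj.symm hvy))
  · exact Or.inr (nonempty_embedding_house (a := z) (b := u) (c := v) (d := y) (e := x)
      (fun w => by grind [hW w]) huz huv hvy.symm hxy.symm hxz.symm hyz.symm hvz
      (mt Adj.symm huy) (mt Adj.symm hux) (mt Adj.symm hvx))
  · exact Or.inl (nonempty_embedding_butterfly (a := z) (b := x) (c := y) (d := u) (e := v)
      (fun w => by grind [hW w]) hxz.symm hyz.symm hxy huz hvz huv hux hvx huy hvy)

theorem nonempty_embedding_of_two_edges (hM : ThetaMarking H α β)
    (hW : ∀ w, w = x ∨ w = y ∨ w = u ∨ w = v) (hxy : H.Adj x y) (huv : H.Adj u v)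
    (hx : x ≠ u ∧ x ≠ v) (hy : y ≠ u ∧ y ≠ v) :
    Nonempty (H ↪g diamond) ∨ Nonempty (H ↪g butterfly) ∨ Nonempty (H ↪g house) := by
  have triangle : ∀ p q r s, (∀ w, w = p ∨ w = q ∨ w = r ∨ w = s) → H.Adj p q → H.Adj p r →
      H.Adj q r → s ≠ p → s ≠ q → s ≠ r →
      Nonempty (H ↪g diamond) ∨ Nonempty (H ↪g butterfly) ∨ Nonempty (H ↪g house) :=
    fun p q r s hw hpq hpr hqr h1 h2 h3 => or_assoc.1 <| Or.inl <|
      hM.nonempty_embedding_of_triangle_add_vertex hw hpq hpr hqr h1 h2 h3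
  by_cases hxu : H.Adj x u <;> by_cases hxv : H.Adj x v
  · exact triangle x u v y (fun w => by grind [hW w]) hxu hxv huv hxy.ne' hy.1 hy.2
  · by_cases hyu : H.Adj y u
    · exact triangle x y u v (fun w => by grind [hW w]) hxy hxu hyu hx.2.symm hy.2.symm huv.ne'
    by_cases hyv : H.Adj y v
    · exact Or.inr (Or.inr (nonempty_embedding_house_of_square (a := x) (b := y) (c := v)
        (d := u) (fun w => by grind [hW w]) hxy hyv huv.symm hxu hxv hyu))
    · exact Or.inr (Or.inr (nonempty_embedding_house_of_path (a := y) (b := x) (c := u)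
        (d := v) (fun w => by grind [hW w]) hxy.symm hxu huv hyu hyv hxv))
  · by_cases hyv : H.Adj y v
    · exact triangle x y v u (fun w => by grind [hW w]) hxy hxv hyv hx.1.symm hy.1.symm huv.ne
    by_cases hyu : H.Adj y u
    · exact Or.inr (Or.inr (nonempty_embedding_house_of_square (a := x) (b := y) (c := u)
        (d := v) (fun w => by grind [hW w]) hxy hyu huv hxv hxu hyv))
    · exact Or.inr (Or.inr (nonempty_embedding_house_of_path (a := y) (b := x) (c := v)
        (d := u) (fun w => by grind [hW w]) hxy.symm hxv huv.symm hyv hyu hxu))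
  · by_cases hyu : H.Adj y u <;> by_cases hyv : H.Adj y v
    · exact triangle y u v x (fun w => by grind [hW w]) hyu hyv huv hxy.ne hx.1 hx.2
    · exact Or.inr (Or.inr (nonempty_embedding_house_of_path (a := x) (b := y) (c := u)
        (d := v) (fun w => by grind [hW w]) hxy hyu huv hxu hxv hyv))
    · exact Or.inr (Or.inr (nonempty_embedding_house_of_path (a := x) (b := y) (c := v)
        (d := u) (fun w => by grind [hW w]) hxy hyv huv.symm hxv hxu hyu))
    · exact Or.inr (Or.inl (nonempty_embedding_butterfly_of_two_edges (a := x) (b := y)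
        (c := u) (d := v) hW hxy huv hxu hxv hyu hyv))

theorem card_le_three_of_isClique (hM : ThetaMarking H α β) {s : Finset W}
    (hs : H.IsClique (s : Set W)) : s.card ≤ 3 := by
  by_contra! h
  obtain ⟨a, ha, b, hb, c, hc, d, hd, hab, hac, had, hbc, hbd, hcd⟩ := Finset.three_lt_card.1 h
  exact hM.false_of_clique (hs ha hb hab) (hs ha hc hac) (hs hb hc hbc) (hs ha hd had)
    (hs hb hd hbd) (hs hc hd hcd)

theorem nonempty_embedding_of_clique_cover (hM : ThetaMarking H α β) {A B : Finset W}
    (hA : H.IsClique (A : Set W)) (hB : H.IsClique (B : Set W)) (hAB : Disjoint A B)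
    (hcover : ∀ w, w ∈ A ∨ w ∈ B) (hle : B.card ≤ A.card) :
    Nonempty (H ↪g diamond) ∨ Nonempty (H ↪g butterfly) ∨ Nonempty (H ↪g house) := by
  classical
  have hA3 := hM.card_le_three_of_isClique hA
  obtain hA2 | hA3 : A.card ≤ 2 ∨ A.card = 3 := by omega
  · obtain hA1 | hA2 : A.card ≤ 1 ∨ A.card = 2 := by omega
    · obtain hA0 | hA1 : A.card = 0 ∨ A.card = 1 := by omega
      · have hB0 : B.card = 0 := by omega
        rw [Finset.card_eq_zero] at hA0 hB0
        subst hA0 hB0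
        have : IsEmpty W := ⟨fun w => by simpa using hcover w⟩
        exact Or.inl ⟨⟨⟨isEmptyElim, fun w => isEmptyElim w⟩, fun {w} => isEmptyElim w⟩⟩
      · obtain ⟨x, rfl⟩ := Finset.card_eq_one.1 hA1
        obtain hB0 | hB1 : B.card = 0 ∨ B.card = 1 := by omega
        · rw [Finset.card_eq_zero] at hB0
          subst hB0
          exact Or.inr (Or.inl (nonempty_embedding_butterfly_of_pair (a := x) (b := x)
            (by simpa using hcover)))
        · obtain ⟨u, rfl⟩ := Finset.card_eq_one.1 hB1
          exact Or.inr (Or.inl (nonempty_embedding_butterfly_of_pair (a := x) (b := u)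
            (by simpa using hcover)))
    · obtain ⟨x, y, hxy, rfl⟩ := Finset.card_eq_two.1 hA2
      replace hxy : H.Adj x y := hA (by simp) (by simp) hxy
      obtain hB0 | hB1 | hB2 : B.card = 0 ∨ B.card = 1 ∨ B.card = 2 := by omega
      · rw [Finset.card_eq_zero] at hB0
        subst hB0
        exact Or.inr (Or.inl (nonempty_embedding_butterfly_of_pair (a := x) (b := y)
          (by simpa using hcover)))
      · obtain ⟨u, rfl⟩ := Finset.card_eq_one.1 hB1
        replace hcover : ∀ w, w = x ∨ w = y ∨ w = u := by simpa [or_assoc] using hcover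
        refine Or.inr (Or.inl ?_)
        by_cases hxu : H.Adj x u <;> by_cases hyu : H.Adj y u
        · exact nonempty_embedding_butterfly_of_triangle hcover hxy hxu hyu
        · exact nonempty_embedding_butterfly_of_cherry hcover hxy hxu hyu
        · exact nonempty_embedding_butterfly_of_cherry (a := y) (b := x) (c := u)
            (fun w => by grind [hcover w]) hxy.symm hyu hxu
        · exact nonempty_embedding_butterfly_of_edge_add_vertex hcover hxy hxu hyu
      · obtain ⟨u, v, huv, rfl⟩ := Finset.card_eq_two.1 hB2
        replace huv : H.Adj u v := hB (by simp) (by simp) huv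
        rw [Finset.disjoint_left] at hAB
        simp only [Finset.mem_singleton, Finset.mem_insert, not_or] at hAB
        exact hM.nonempty_embedding_of_two_edges (x := x) (y := y) (u := u) (v := v)
          (by simpa [or_assoc] using hcover) hxy huv (by grind) (by grind)
  · obtain ⟨x, y, z, hxy, hxz, hyz, rfl⟩ := Finset.card_eq_three.1 hA3
    replace hxy : H.Adj x y := hA (by simp) (by simp) hxy
    replace hxz : H.Adj x z := hA (by simp) (by simp) hxz
    replace hyz : H.Adj y z := hA (by simp) (by simp) hyz
    obtain hB0 | hB1 | hB2 | hB3 : B.card = 0 ∨ B.card = 1 ∨ B.card = 2 ∨ B.card = 3 := by omega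
    · rw [Finset.card_eq_zero] at hB0
      subst hB0
      exact Or.inr (Or.inl (nonempty_embedding_butterfly_of_triangle
        (by simpa using hcover) hxy hxz hyz))
    · obtain ⟨u, rfl⟩ := Finset.card_eq_one.1 hB1
      rw [Finset.disjoint_left] at hAB
      simp only [Finset.mem_singleton, Finset.mem_insert] at hAB
      exact or_assoc.1 (Or.inl (hM.nonempty_embedding_of_triangle_add_vertex (u := u)
        (by simpa [or_assoc] using hcover) hxy hxz hyz (by grind) (by grind) (by grind)))
    · obtain ⟨u, v, huv, rfl⟩ := Finset.card_eq_two.1 hB2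
      replace huv : H.Adj u v := hB (by simp) (by simp) huv
      rw [Finset.disjoint_left] at hAB
      simp only [Finset.mem_singleton, Finset.mem_insert, not_or] at hAB
      exact Or.inr (hM.nonempty_embedding_of_triangle_add_edge (u := u) (v := v)
        (by simpa [or_assoc] using hcover) hxy hxz hyz huv (by grind) (by grind))
    · obtain ⟨u, v, w, huv, huw, hvw, rfl⟩ := Finset.card_eq_three.1 hB3
      rw [Finset.disjoint_left] at hAB
      simp only [Finset.mem_singleton, Finset.mem_insert, not_or] at hAB
      exact (hM.false_of_disjoint_triangles hxy hxz hyz (hB (by simp) (by simp) huv)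
        (hB (by simp) (by simp) huw) (hB (by simp) (by simp) hvw)
        (by grind) (by grind) (by grind)).elim

end ThetaMarking

theorem induced_minor_of_prism_and_theta {W : Type} [Fintype W] (H : SimpleGraph W)
    (k ℓ : ℕ) (hk : 3 ≤ k) (hℓ : 3 ≤ ℓ)
    (hprism : InducedMinor H (prismGraph k)) (htheta : InducedMinor H (thetaGraph ℓ)) :
    Nonempty (H ↪g diamond) ∨ Nonempty (H ↪g butterfly) ∨ Nonempty (H ↪g house) := by
  classical
  obtain ⟨P, hP, hQ⟩ := hprism.exists_clique_cover_of_prismGraph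
  obtain ⟨α, β, hM⟩ := htheta.exists_thetaMarking
  have hA : H.IsClique ((Finset.univ.filter P : Finset W) : Set W) := fun u hu w hw huw =>
    hP u w huw (by simpa using hu) (by simpa using hw)
  have hB : H.IsClique ((Finset.univ.filter (¬ P ·) : Finset W) : Set W) := fun u hu w hw huw =>
    hQ u w huw (by simpa using hu) (by simpa using hw)
  have hAB : Disjoint (Finset.univ.filter P) (Finset.univ.filter (¬ P ·)) :=
    Finset.disjoint_filter_filter_not _ _ _
  rcases le_total (Finset.univ.filter (¬ P ·)).card (Finset.univ.filter P).card with hle | hle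
  · exact hM.nonempty_embedding_of_clique_cover hA hB hAB (fun w => by simp [em]) hle
  · exact hM.nonempty_embedding_of_clique_cover hB hA hAB.symm (fun w => by simp [em']) hle
end

section
/- For every integer ℓ ≥ 3, the ℓ-theta does not contain the disjoint union of a triangle and a single vertex (the graph K_3 + P_1) as an induced minor. -/
open SimpleGraph

/-- The neighbours of the degree-two vertex `(i, s)` of a theta are the hub `s` and the other
inner vertex of the same path. -/
theorem thetaGraph_adj_inr {k : ℕ} {i : Fin k} {s : Fin 2} {w : Fin 2 ⊕ Fin k × Fin 2}
    (h : (thetaGraph k).Adj (Sum.inr (i, s)) w) :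
    w = Sum.inl s ∨ w = Sum.inr (i, 1 - s) := by
  fin_cases s <;> simp [thetaGraph] at h ⊢ <;> grind

theorem thetaGraph_adj_hub {k : ℕ} (i : Fin k) (s : Fin 2) :
    (thetaGraph k).Adj (Sum.inr (i, s)) (Sum.inl s) := by
  fin_cases s <;> simp [thetaGraph]

/-- A point without neighbours in a connected set is the only point of that set. -/
theorem eq_of_connected_induce_of_forall_not_adj {V : Type} {G : SimpleGraph V} {X : Set V}
    (hX : (G.induce X).Connected) {x y : V} (hx : x ∈ X) (hy : y ∈ X)
    (h : ∀ w ∈ X, ¬ G.Adj x w) : y = x := by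
  by_contra hne
  have : Nontrivial X := ⟨⟨y, hy⟩, ⟨x, hx⟩, fun e => hne (congrArg Subtype.val e)⟩
  obtain ⟨w, hw⟩ := hX.preconnected.exists_adj_of_nontrivial ⟨x, hx⟩
  exact h w w.2 hw

/-- If a connected set `X` contains `(i, s)`, avoids the hub `s`, and the partner of `(i, s)` lies
outside both `X` and `Z`, then no edge joins `X` to a set `Z` avoiding the hub `s`. -/
theorem thetaGraph_not_adj_of_leaf {k : ℕ} {X Z : Set (Fin 2 ⊕ Fin k × Fin 2)}
    (hX : ((thetaGraph k).induce X).Connected) {i : Fin k} {s : Fin 2}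
    (hx : Sum.inr (i, s) ∈ X) (hsX : Sum.inl s ∉ X) (hsZ : Sum.inl s ∉ Z)
    (hpX : Sum.inr (i, 1 - s) ∉ X) (hpZ : Sum.inr (i, 1 - s) ∉ Z)
    {x z : Fin 2 ⊕ Fin k × Fin 2} (hxX : x ∈ X) (hzZ : z ∈ Z) :
    ¬ (thetaGraph k).Adj x z := by
  have e : x = Sum.inr (i, s) := eq_of_connected_induce_of_forall_not_adj hX hx hxX
    fun w hw hadj => by
      rcases thetaGraph_adj_inr hadj with rfl | rfl
      exacts [hsX hw, hpX hw]
  rintro hadj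
  subst e
  rcases thetaGraph_adj_inr hadj with rfl | rfl
  exacts [hsZ hzZ, hpZ hzZ]

/-- There is no model of a triangle in a theta minus the hub `c`, where `X` and `Y` are the
branch sets avoiding the other hub. -/
theorem thetaGraph_no_triangle_model {k : ℕ} {c : Fin 2} {X Y Z : Set (Fin 2 ⊕ Fin k × Fin 2)}
    (hX : ((thetaGraph k).induce X).Connected) (hY : ((thetaGraph k).induce Y).Connected)
    (hXY : Disjoint X Y) (hXZ : Disjoint X Z) (hYZ : Disjoint Y Z)
    (hcX : Sum.inl c ∉ X) (hcY : Sum.inl c ∉ Y) (hcZ : Sum.inl c ∉ Z)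
    (hdX : Sum.inl (1 - c) ∉ X) (hdY : Sum.inl (1 - c) ∉ Y)
    (aXY : ∃ a ∈ X, ∃ b ∈ Y, (thetaGraph k).Adj a b)
    (aXZ : ∃ a ∈ X, ∃ b ∈ Z, (thetaGraph k).Adj a b)
    (aYZ : ∃ a ∈ Y, ∃ b ∈ Z, (thetaGraph k).Adj a b) : False := by
  have fin_two : ∀ s : Fin 2, s = c ∨ s = 1 - c := (by decide : ∀ c s : Fin 2, s = c ∨ s = 1 - c) c
  have sub_sub : 1 - (1 - c) = c := sub_sub_cancel 1 c
  obtain ⟨x, hx, y, hy, hxy⟩ := aXY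
  obtain ⟨x', hx', z, hz, hxz⟩ := aXZ
  obtain ⟨y', hy', z', hz', hyz⟩ := aYZ
  rcases x with s | ⟨i, s⟩
  · rcases fin_two s with rfl | rfl
    exacts [hcX hx, hdX hx]
  rcases thetaGraph_adj_inr hxy with rfl | rfl
  · rcases fin_two s with rfl | rfl
    exacts [hcY hy, hdY hy]
  rcases fin_two s with rfl | rfl
  · exact thetaGraph_not_adj_of_leaf hX hx hcX hcZ (hXY.notMem_of_mem_right hy)
      (hYZ.notMem_of_mem_left hy) hx' hz hxz
  · rw [sub_sub] at hy
    exact thetaGraph_not_adj_of_leaf hY hy hcY hcZ (hXY.notMem_of_mem_left hx)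
      (hXZ.notMem_of_mem_left hx) hy' hz' hyz

theorem theta_no_K3_plus_P1_induced_minor (ℓ : ℕ) (hℓ : 3 ≤ ℓ) :
    ¬ InducedMinor k3PlusP1 (thetaGraph ℓ) := by
  rintro ⟨X, hne, hconn, hdisj, hadj, hnadj⟩
  have a01 := hadj 0 1 (by simp [k3PlusP1])
  have a02 := hadj 0 2 (by simp [k3PlusP1])
  have a12 := hadj 1 2 (by simp [k3PlusP1])
  have a10 := hadj 1 0 (by simp [k3PlusP1])
  have a20 := hadj 2 0 (by simp [k3PlusP1])
  have a21 := hadj 2 1 (by simp [k3PlusP1])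
  have isolated : ∀ j : Fin 4, j ≠ 3 → ¬ k3PlusP1.Adj 3 j := by
    intro j hj
    fin_cases j <;> simp [k3PlusP1]
  obtain ⟨c, hc⟩ : ∃ c : Fin 2, ∀ j, j ≠ 3 → Sum.inl c ∉ X j := by
    obtain ⟨c | ⟨i, c⟩, hv⟩ := hne 3
    · exact ⟨c, fun j hj => (hdisj hj.symm).notMem_of_mem_left hv⟩
    · exact ⟨c, fun j hj hmem =>
        hnadj 3 j hj.symm (isolated j hj) _ hv _ hmem (thetaGraph_adj_hub i c)⟩
  have d01 : Disjoint (X 0) (X 1) := hdisj (by decide)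
  have d02 : Disjoint (X 0) (X 2) := hdisj (by decide)
  have d12 : Disjoint (X 1) (X 2) := hdisj (by decide)
  have c0 := hc 0 (by decide)
  have c1 := hc 1 (by decide)
  have c2 := hc 2 (by decide)
  by_cases h0 : Sum.inl (1 - c) ∈ X 0
  · exact thetaGraph_no_triangle_model (hconn 1) (hconn 2) d12 d01.symm d02.symm c1 c2 c0
      (d01.notMem_of_mem_left h0) (d02.notMem_of_mem_left h0) a12 a10 a20
  by_cases h1 : Sum.inl (1 - c) ∈ X 1
  · exact thetaGraph_no_triangle_model (hconn 0) (hconn 2) d02 d01 d12.symm c0 c2 c1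
      h0 (d12.notMem_of_mem_left h1) a02 a01 a21
  · exact thetaGraph_no_triangle_model (hconn 0) (hconn 1) d01 d02 d12 c0 c1 c2
      h0 h1 a01 a02 a12
end

section
/- A finite simple graph G does not contain any induced subdivision of the house if and only if G is long-unichord-free and long-theta-free. -/
open SimpleGraph

theorem subdivideEdge_adj_some_some {W : Type} (H : SimpleGraph W) (u v a b : W) :
    (subdivideEdge H u v).Adj (some a) (some b) ↔ H.Adj a b ∧ s(a, b) ≠ s(u, v) := by
  have := H.adj_comm a b
  have hne := H.ne_of_adj (a := a) (b := b)
  simp only [subdivideEdge, SimpleGraph.fromRel_adj, Sym2.eq_iff, ne_eq]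
  grind

theorem subdivideEdge_adj_none_some {W : Type} (H : SimpleGraph W) (u v b : W) :
    (subdivideEdge H u v).Adj none (some b) ↔ b = u ∨ b = v := by
  simp [subdivideEdge, SimpleGraph.fromRel_adj]

theorem subdivideEdge_comm {W : Type} (H : SimpleGraph W) (u v : W) :
    subdivideEdge H u v = subdivideEdge H v u := by
  ext x y
  simp only [subdivideEdge, SimpleGraph.fromRel_adj]
  grind

/-- The functions `f 0`, `f 1`, `f 2` trace three paths of lengths `L 0`, `L 1`, `L 2` in `G` with
common ends, internally disjoint, and such that the graph induced on their vertices has no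
other edges. A path of length one is allowed. -/
structure IsInducedTheta {V : Type} (G : SimpleGraph V) (L : Fin 3 → ℕ) (f : Fin 3 → ℕ → V) :
    Prop where
  start_eq : ∀ i j, f i 0 = f j 0
  finish_eq : ∀ i j, f i (L i) = f j (L j)
  inj : ∀ i j s t, s ≤ L i → t ≤ L j → f i s = f j t →
    (i = j ∧ s = t) ∨ (s = 0 ∧ t = 0) ∨ (s = L i ∧ t = L j)
  adj : ∀ i s, s < L i → G.Adj (f i s) (f i (s + 1))
  chordless : ∀ i j s t, s ≤ L i → t ≤ L j → G.Adj (f i s) (f j t) →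
    ∃ k r, r < L k ∧ s(f i s, f j t) = s(f k r, f k (r + 1))

/-- An induced theta that covers all vertices of the graph. -/
structure IsSpanningTheta {V : Type} (G : SimpleGraph V) (L : Fin 3 → ℕ) (f : Fin 3 → ℕ → V) :
    Prop extends IsInducedTheta G L f where
  surj : ∀ x, ∃ i s, s ≤ L i ∧ f i s = x

namespace IsInducedTheta

variable {V W : Type} {G : SimpleGraph V} {H : SimpleGraph W} {L : Fin 3 → ℕ}
  {f : Fin 3 → ℕ → V} {g : Fin 3 → ℕ → W}

theorem map (h : IsInducedTheta G L f) (e : G ↪g H) :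
    IsInducedTheta H L (fun i s => e (f i s)) where
  start_eq i j := congrArg e (h.start_eq i j)
  finish_eq i j := congrArg e (h.finish_eq i j)
  inj i j s t hs ht hst := h.inj i j s t hs ht (e.injective hst)
  adj i s hs := e.map_adj_iff.2 (h.adj i s hs)
  chordless i j s t hs ht hst := by
    obtain ⟨k, r, hr, hkr⟩ := h.chordless i j s t hs ht (e.map_adj_iff.1 hst)
    refine ⟨k, r, hr, ?_⟩
    simpa using congrArg (Sym2.map e) hkr

theorem perm (h : IsInducedTheta G L f) (σ : Equiv.Perm (Fin 3)) :
    IsInducedTheta G (fun i => L (σ i)) (fun i => f (σ i)) where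
  start_eq i j := h.start_eq _ _
  finish_eq i j := h.finish_eq _ _
  inj i j s t hs ht hst := by
    simpa using h.inj _ _ s t hs ht hst
  adj i s hs := h.adj _ s hs
  chordless i j s t hs ht hst := by
    obtain ⟨k, r, hr, hkr⟩ := h.chordless _ _ s t hs ht hst
    exact ⟨σ.symm k, r, by simpa using hr, by simpa using hkr⟩

theorem eq_iff (h : IsInducedTheta G L f) {i j : Fin 3} {s t : ℕ} (hs : s ≤ L i) (ht : t ≤ L j) :
    f i s = f j t ↔ (i = j ∧ s = t) ∨ (s = 0 ∧ t = 0) ∨ (s = L i ∧ t = L j) := by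
  refine ⟨h.inj i j s t hs ht, ?_⟩
  rintro (⟨rfl, rfl⟩ | ⟨rfl, rfl⟩ | ⟨rfl, rfl⟩)
  exacts [rfl, h.start_eq i j, h.finish_eq i j]

theorem adj_iff (h : IsInducedTheta G L f) {i j : Fin 3} {s t : ℕ} (hs : s ≤ L i) (ht : t ≤ L j) :
    G.Adj (f i s) (f j t) ↔ ∃ k r, r < L k ∧ s(f i s, f j t) = s(f k r, f k (r + 1)) := by
  refine ⟨h.chordless i j s t hs ht, ?_⟩
  rintro ⟨k, r, hr, hkr⟩
  rw [← SimpleGraph.mem_edgeSet, hkr]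
  exact h.adj k r hr

theorem edge_inj (h : IsInducedTheta G L f) (hL : ∀ i j, i ≠ j → 3 ≤ L i + L j)
    {i j : Fin 3} {s t : ℕ} (hs : s < L i) (ht : t < L j)
    (hst : s(f i s, f i (s + 1)) = s(f j t, f j (t + 1))) : i = j ∧ s = t := by
  have h1 := h.inj i j s t
  have h2 := h.inj i j (s + 1) (t + 1)
  have h3 := h.inj i j s (t + 1)
  have h4 := h.inj i j (s + 1) t
  have := hL i j
  rw [Sym2.eq_iff] at hst
  grind

end IsInducedTheta

namespace IsSpanningTheta

variable {V W : Type} {G : SimpleGraph V} {H : SimpleGraph W} {L : Fin 3 → ℕ}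
  {f : Fin 3 → ℕ → V} {g : Fin 3 → ℕ → W}

/-- The graph spanned by a theta embeds into any graph with an induced theta of the same type. -/
theorem nonempty_embedding (h : IsSpanningTheta G L f) (h' : IsInducedTheta H L g) :
    Nonempty (G ↪g H) := by
  choose I S hS hf using h.surj
  have key : ∀ i s, s ≤ L i → g (I (f i s)) (S (f i s)) = g i s := by
    intro i s hs
    rw [h'.eq_iff (hS _) hs, ← h.eq_iff (hS _) hs, hf]
  have inj : ∀ x y, g (I x) (S x) = g (I y) (S y) ↔ x = y := by
    intro x y
    rw [h'.eq_iff (hS _) (hS _), ← h.eq_iff (hS _) (hS _), hf, hf]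
  refine ⟨⟨⟨fun x => g (I x) (S x), fun x y hxy => (inj x y).1 hxy⟩, ?_⟩⟩
  intro x y
  change H.Adj (g (I x) (S x)) (g (I y) (S y)) ↔ G.Adj x y
  rw [h'.adj_iff (hS _) (hS _)]
  conv_rhs => rw [← hf x, ← hf y, h.adj_iff (hS _) (hS _), hf, hf]
  refine exists_congr fun k => exists_congr fun r => and_congr_right fun hr => ?_
  rw [← key k r hr.le, ← key k (r + 1) hr, Sym2.eq_iff, Sym2.eq_iff]
  simp only [inj]

/-- Subdividing the `r`-th edge of the `k`-th path lengthens that path by one. -/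
theorem subdivide (h : IsSpanningTheta G L f) (hL : ∀ i j, i ≠ j → 3 ≤ L i + L j)
    {k : Fin 3} {r : ℕ} (hr : r < L k) :
    IsSpanningTheta (subdivideEdge G (f k r) (f k (r + 1))) (L + Pi.single k 1)
      (fun i s => if i = k then
        (if s ≤ r then some (f k s) else if s = r + 1 then none else some (f k (s - 1)))
        else some (f i s)) := by
  have hLk : (L + Pi.single k 1 : Fin 3 → ℕ) k = L k + 1 := by simp
  have hLi : ∀ i, i ≠ k → (L + Pi.single k 1 : Fin 3 → ℕ) i = L i := by
    intro i hi; simp [hi]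
  generalize (L + Pi.single k 1 : Fin 3 → ℕ) = L' at hLk hLi
  set f' : Fin 3 → ℕ → Option V := fun i s => if i = k then
        (if s ≤ r then some (f k s) else if s = r + 1 then none else some (f k (s - 1)))
        else some (f i s) with hf'
  have lift : ∀ i s, s < L i → ¬ (i = k ∧ s = r) →
      ∃ s', s' < L' i ∧ f' i s' = some (f i s) ∧ f' i (s' + 1) = some (f i (s + 1)) := by
    intro i s hs hne
    by_cases hi : i = k
    · subst hi
      by_cases hsr : s < r
      · refine ⟨s, by omega, ?_, ?_⟩ <;> simp only [hf'] <;> grind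
      · refine ⟨s + 1, by omega, ?_, ?_⟩ <;> simp only [hf'] <;> grind
    · exact ⟨s, by grind, by simp [hf', hi], by simp [hf', hi]⟩
  have desc : ∀ i s, s ≤ L' i → f' i s = none ∧ i = k ∧ s = r + 1 ∨
      ∃ s', s' ≤ L i ∧ f' i s = some (f i s') ∧ (s' = 0 ↔ s = 0) ∧ (s' = L i ↔ s = L' i) ∧
        (s = if i = k ∧ r < s' then s' + 1 else s') := by
    intro i s hs
    by_cases hi : i = k
    · subst hi
      by_cases h1 : s ≤ r
      · exact .inr ⟨s, by omega, by simp [hf', h1], by grind, by grind, by grind⟩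
      · by_cases h2 : s = r + 1
        · exact .inl ⟨by simp [hf', h2], rfl, h2⟩
        · exact .inr ⟨s - 1, by omega, by simp [hf', h1, h2], by grind, by grind, by grind⟩
    · have := hLi i hi
      exact .inr ⟨s, by omega, by simp [hf', hi], by grind, by grind, by grind⟩
  have mid0 : f' k r = some (f k r) := by simp [hf']
  have mid1 : f' k (r + 1) = none := by simp [hf']
  have mid2 : f' k (r + 1 + 1) = some (f k (r + 1)) := by simp [hf']
  refine ⟨⟨?_, ?_, ?_, ?_, ?_⟩, ?_⟩
  · intro i j
    have := h.start_eq i j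
    have := h.start_eq i k
    have := h.start_eq k j
    simp only [hf']
    grind
  · have : ∀ i, f' i (L' i) = some (f i (L i)) := by
      intro i
      by_cases hi : i = k
      · subst hi
        simp only [hf']; grind
      · simp [hf', hi, hLi i hi]
    intro i j
    rw [this, this, h.finish_eq i j]
  · intro i j s t hs ht hst
    rcases desc i s hs with ⟨h1, h2, h3⟩ | ⟨s', h1, h2, h3, h4, h5⟩ <;>
    rcases desc j t ht with ⟨k1, k2, k3⟩ | ⟨t', k1, k2, k3, k4, k5⟩
    · grind
    · rw [h1, k2] at hst; cases hst
    · rw [h2, k1] at hst; cases hst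
    · rw [h2, k2, Option.some_inj] at hst
      have := h.inj _ _ _ _ h1 k1 hst
      grind
  · intro i s hs
    by_cases hi : i = k
    · subst hi
      rcases lt_trichotomy s r with hsr | hsr | hsr
      · have e1 : f' i s = some (f i s) := by simp [hf', hsr.le]
        have e2 : f' i (s + 1) = some (f i (s + 1)) := by
          simp [hf', Nat.succ_le_of_lt hsr]
        rw [e1, e2, subdivideEdge_adj_some_some]
        refine ⟨h.adj _ _ (by omega), fun he => ?_⟩
        have := h.edge_inj hL (by omega) hr he
        omega
      · subst hsr
        rw [mid0, mid1, SimpleGraph.adj_comm, subdivideEdge_adj_none_some]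
        exact .inl rfl
      · by_cases hsr' : s = r + 1
        · subst hsr'
          rw [mid1, mid2, subdivideEdge_adj_none_some]
          exact .inr rfl
        · obtain ⟨s, rfl⟩ : ∃ s₁, s = s₁ + 1 := ⟨s - 1, by omega⟩
          have e1 : f' i (s + 1) = some (f i s) := by simp only [hf']; grind
          have e2 : f' i (s + 1 + 1) = some (f i (s + 1)) := by simp only [hf']; grind
          rw [e1, e2, subdivideEdge_adj_some_some]
          refine ⟨h.adj _ _ (by omega), fun he => ?_⟩
          have := h.edge_inj hL (by omega) hr he
          omega
    · have hs' : s < L i := hLi i hi ▸ hs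
      have e : ∀ t, f' i t = some (f i t) := by simp [hf', hi]
      rw [e, e, subdivideEdge_adj_some_some]
      exact ⟨h.adj i s hs', fun he => hi (h.edge_inj hL hs' hr he).1⟩
  · have hnone : ∀ y, (subdivideEdge G (f k r) (f k (r + 1))).Adj none (some y) →
        ∃ k' r', r' < L' k' ∧ s(none, some y) = s(f' k' r', f' k' (r' + 1)) := by
      intro y hy
      rcases (subdivideEdge_adj_none_some _ _ _ _).1 hy with rfl | rfl
      · exact ⟨k, r, by omega, by rw [mid0, mid1, Sym2.eq_swap]⟩
      · exact ⟨k, r + 1, by omega, by rw [mid1, mid2]⟩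
    intro i j s t hs ht hst
    rcases desc i s hs with ⟨h1, h2, h3⟩ | ⟨s', h1, h2, h3, h4, h5⟩ <;>
    rcases desc j t ht with ⟨k1, k2, k3⟩ | ⟨t', k1, k2, k3, k4, k5⟩
    · rw [h1, k1] at hst; exact (hst.ne rfl).elim
    · rw [h1, k2] at hst ⊢; exact hnone _ hst
    · rw [h2, k1] at hst ⊢
      rw [Sym2.eq_swap]
      exact hnone _ hst.symm
    · rw [h2, k2] at hst ⊢
      rw [subdivideEdge_adj_some_some] at hst
      obtain ⟨k', r', hr', he⟩ := h.chordless _ _ _ _ h1 k1 hst.1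
      obtain ⟨s₁, hs₁, e1, e2⟩ := lift k' r' hr' (by
        rintro ⟨rfl, rfl⟩; exact hst.2 he)
      refine ⟨k', s₁, hs₁, ?_⟩
      rw [e1, e2]
      simpa using congrArg (Sym2.map some) he
  · rintro (_ | x)
    · exact ⟨k, r + 1, by omega, mid1⟩
    · obtain ⟨i, s, hs, rfl⟩ := h.surj x
      by_cases hi : i = k
      · subst hi
        by_cases hsr : s ≤ r
        · exact ⟨i, s, by omega, by simp [hf', hsr]⟩
        · exact ⟨i, s + 1, by omega, by simp only [hf']; grind⟩
      · exact ⟨i, s, by rw [hLi i hi]; exact hs, by simp [hf', hi]⟩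

end IsSpanningTheta

instance inst_s16 : DecidableRel house.Adj :=
  inferInstanceAs (DecidableRel (SimpleGraph.fromRel _).Adj)

theorem isSpanningTheta_house :
    IsSpanningTheta house ![1, 3, 2] (fun i s =>
      (![![0, 3, 0, 0], ![0, 1, 2, 3], ![0, 4, 3, 0]] i : Fin 4 → Fin 5) (Fin.ofNat 4 s)) := by
  have bound : ∀ i : Fin 3, ∀ s : ℕ, s ≤ (![1, 3, 2] : Fin 3 → ℕ) i → s < 4 := by
    intro i s hs
    fin_cases i <;> simp at hs <;> omega
  refine ⟨⟨by decide, by decide, ?_, ?_, ?_⟩, ?_⟩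
  · intro i j s t hs ht
    fin_cases i <;> fin_cases j <;> simp at hs ht <;> interval_cases s <;> interval_cases t <;>
      decide
  · intro i s hs
    have := bound i s hs.le
    interval_cases s <;> revert i <;> decide
  · intro i j s t _ _
    have key : ∀ x y : Fin 5, house.Adj x y → ∃ k : Fin 3, ∃ r : Fin 3,
        r.val < (![1, 3, 2] : Fin 3 → ℕ) k ∧ s(x, y) =
          s((![![0, 3, 0, 0], ![0, 1, 2, 3], ![0, 4, 3, 0]] k : Fin 4 → Fin 5) (Fin.ofNat 4 r),
            (![![0, 3, 0, 0], ![0, 1, 2, 3], ![0, 4, 3, 0]] k : Fin 4 → Fin 5)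
              (Fin.ofNat 4 (r + 1))) := by
      decide
    intro hst
    obtain ⟨k, r, hr, he⟩ := key _ _ hst
    exact ⟨k, r, hr, he⟩
  · have key : ∀ x : Fin 5, ∃ i : Fin 3, ∃ s : Fin 4, s.val ≤ (![1, 3, 2] : Fin 3 → ℕ) i ∧
        (![![0, 3, 0, 0], ![0, 1, 2, 3], ![0, 4, 3, 0]] i : Fin 4 → Fin 5) (Fin.ofNat 4 s) = x := by
      decide
    intro x
    obtain ⟨i, s, hs, he⟩ := key x
    exact ⟨i, s, hs, he⟩

/-- A subdivision of the house is spanned by a theta. -/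
theorem Subdivision.exists_isSpanningTheta {A : Type} {H : SimpleGraph A}
    (h : Subdivision house H) :
    ∃ L f, IsSpanningTheta H L f ∧ 1 ≤ L 0 ∧ 3 ≤ L 1 ∧ 2 ≤ L 2 := by
  induction h with
  | refl => exact ⟨_, _, isSpanningTheta_house, by simp⟩
  | @step B H u v _ huv ih =>
    obtain ⟨L, f, hf, h0, h1, h2⟩ := ih
    obtain ⟨i, s, hs, rfl⟩ := hf.surj u
    obtain ⟨j, t, ht, rfl⟩ := hf.surj v
    obtain ⟨k, r, hr, he⟩ := hf.chordless i j s t hs ht huv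
    have hL : ∀ i j, i ≠ j → 3 ≤ L i + L j := by
      intro i j hij
      fin_cases i <;> fin_cases j <;> simp at hij ⊢ <;> omega
    have hg : subdivideEdge H (f i s) (f j t) = subdivideEdge H (f k r) (f k (r + 1)) := by
      rcases Sym2.eq_iff.1 he with ⟨e1, e2⟩ | ⟨e1, e2⟩
      · rw [e1, e2]
      · rw [e1, e2, subdivideEdge_comm]
    rw [hg]
    refine ⟨_, _, hf.subdivide hL hr, ?_⟩
    simp only [Pi.add_apply]
    omega

/-- Every type of theta with path lengths at least `1`, `3`, `2` spans a subdivision of the house. -/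
theorem exists_subdivision_isSpanningTheta (L : Fin 3 → ℕ) (h0 : 1 ≤ L 0) (h1 : 3 ≤ L 1)
    (h2 : 2 ≤ L 2) :
    ∃ (B : Type) (H : SimpleGraph B) (f : Fin 3 → ℕ → B),
      Subdivision house H ∧ IsSpanningTheta H L f := by
  obtain ⟨M, rfl⟩ : ∃ M : Fin 3 → ℕ, L = ![1, 3, 2] + M := by
    refine ⟨L - ![1, 3, 2], ?_⟩
    ext i
    fin_cases i
    exacts [(Nat.add_sub_of_le h0).symm, (Nat.add_sub_of_le h1).symm, (Nat.add_sub_of_le h2).symm]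
  clear h0 h1 h2
  obtain ⟨n, hn⟩ : ∃ n, n = ∑ i, M i := ⟨_, rfl⟩
  induction n generalizing M with
  | zero =>
    have : M = 0 := by
      ext i
      simpa using (Finset.sum_eq_zero_iff.1 hn.symm) i (Finset.mem_univ i)
    subst this
    exact ⟨_, _, _, .refl _, by simpa using isSpanningTheta_house⟩
  | succ n ih =>
    obtain ⟨k, hk⟩ : ∃ k, M k ≠ 0 := by
      by_contra! hM
      simp [hM] at hn
    obtain ⟨M, rfl⟩ : ∃ M' : Fin 3 → ℕ, M = M' + Pi.single k 1 := by
      refine ⟨M - Pi.single k 1, ?_⟩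
      ext i
      by_cases hi : i = k
      · subst hi; simp; omega
      · simp [hi]
    obtain ⟨B, H, f, hH, hf⟩ := ih M (by
      simp [Finset.sum_add_distrib] at hn
      exact hn)
    have hL : ∀ i j, i ≠ j →
        3 ≤ (![1, 3, 2] + M : Fin 3 → ℕ) i + (![1, 3, 2] + M : Fin 3 → ℕ) j := by
      intro i j hij
      fin_cases i <;> fin_cases j <;> simp at hij ⊢ <;> omega
    have hpos : 0 < (![1, 3, 2] + M : Fin 3 → ℕ) k := by
      fin_cases k <;> simp
    have key := hf.subdivide hL hpos
    rw [add_assoc] at key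
    exact ⟨_, _, _, .step hH (hf.adj k 0 hpos), key⟩

/-- Containing an induced subdivision of the house amounts to containing an induced theta with
path lengths at least `1`, `3`, `2`. -/
theorem containsInducedSubdivision_house_iff {V : Type} (G : SimpleGraph V) :
    ContainsInducedSubdivision house G ↔
      ∃ L f, IsInducedTheta G L f ∧ 1 ≤ L 0 ∧ 3 ≤ L 1 ∧ 2 ≤ L 2 := by
  constructor
  · rintro ⟨B, H, hH, ⟨e⟩⟩
    obtain ⟨L, f, hf, hL⟩ := hH.exists_isSpanningTheta
    exact ⟨L, _, hf.toIsInducedTheta.map e, hL⟩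
  · rintro ⟨L, f, hf, h0, h1, h2⟩
    obtain ⟨B, H, g, hH, hg⟩ := exists_subdivision_isSpanningTheta L h0 h1 h2
    exact ⟨B, H, hH, hg.nonempty_embedding hf⟩

/-- The `s`-th vertex of the `i`-th path of `gammaGraph p q r`. -/
def gammaPath (p q r : ℕ) : Fin 3 → ℕ → Fin 2 ⊕ (Fin p ⊕ (Fin q ⊕ Fin r))
  | 0, 0 => .inl 0
  | 1, 0 => .inl 0
  | 2, 0 => .inl 0
  | 0, s + 1 => if h : s < p then .inr (.inl ⟨s, h⟩) else .inl 1
  | 1, s + 1 => if h : s < q then .inr (.inr (.inl ⟨s, h⟩)) else .inl 1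
  | 2, s + 1 => if h : s < r then .inr (.inr (.inr ⟨s, h⟩)) else .inl 1

theorem SimpleGraph.sym2_of_fromRel_adj {V : Type} {R : V → V → Prop} {P : Sym2 V → Prop}
    (hR : ∀ x y, R x y → P s(x, y)) {x y : V} (h : (SimpleGraph.fromRel R).Adj x y) :
    P s(x, y) := by
  obtain ⟨_, h | h⟩ := h
  · exact hR x y h
  · rw [Sym2.eq_swap]
    exact hR y x h

theorem isSpanningTheta_gammaGraph {p q r : ℕ} (hp : 1 ≤ p) (hq : 1 ≤ q) (hr : 1 ≤ r) :
    IsSpanningTheta (gammaGraph p q r) ![p + 1, q + 1, r + 1] (gammaPath p q r) := by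
  refine ⟨⟨?_, ?_, ?_, ?_, ?_⟩, ?_⟩
  · intro i j
    fin_cases i <;> fin_cases j <;> rfl
  · intro i j
    fin_cases i <;> fin_cases j <;> simp [gammaPath]
  · intro i j s t hs ht hst
    fin_cases i <;> fin_cases j <;> rcases s with _ | s <;> rcases t with _ | t <;>
      simp [gammaPath] at hs ht hst ⊢ <;> grind
  · intro i s hs
    fin_cases i <;> rcases s with _ | s <;> simp at hs
    · simp [gammaPath, gammaGraph, Nat.lt_of_succ_le hp]
    · by_cases h : s + 1 < p <;> (simp [gammaPath, gammaGraph, hs, h]; try omega)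
    · simp [gammaPath, gammaGraph, Nat.lt_of_succ_le hq]
    · by_cases h : s + 1 < q <;> (simp [gammaPath, gammaGraph, hs, h]; try omega)
    · simp [gammaPath, gammaGraph, Nat.lt_of_succ_le hr]
    · by_cases h : s + 1 < r <;> (simp [gammaPath, gammaGraph, hs, h]; try omega)
  · intro i j s t _ _
    refine SimpleGraph.sym2_of_fromRel_adj (P := fun e => ∃ k l,
      l < (![p + 1, q + 1, r + 1] : Fin 3 → ℕ) k ∧
      e = s(gammaPath p q r k l, gammaPath p q r k (l + 1))) ?_
    rintro (x | x | x | x) (y | y | y | y) h <;> simp only at h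
    · omega
    · rcases h with ⟨rfl, h⟩ | ⟨rfl, h⟩
      · exact ⟨0, 0, by simp, by simp [gammaPath]; grind⟩
      · obtain ⟨p, rfl⟩ := Nat.exists_eq_add_of_le' hp
        exact ⟨0, p + 1, by simp, by simp [gammaPath]; grind⟩
    · rcases h with ⟨rfl, h⟩ | ⟨rfl, h⟩
      · exact ⟨1, 0, by simp, by simp [gammaPath]; grind⟩
      · obtain ⟨q, rfl⟩ := Nat.exists_eq_add_of_le' hq
        exact ⟨1, q + 1, by simp, by simp [gammaPath]; grind⟩
    · rcases h with ⟨rfl, h⟩ | ⟨rfl, h⟩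
      · exact ⟨2, 0, by simp, by simp [gammaPath]; grind⟩
      · obtain ⟨r, rfl⟩ := Nat.exists_eq_add_of_le' hr
        exact ⟨2, r + 1, by simp, by simp [gammaPath]; grind⟩
    · exact ⟨0, x + 1, by simp, by simp [gammaPath]; grind⟩
    · exact ⟨1, x + 1, by simp, by simp [gammaPath]; grind⟩
    · exact ⟨2, x + 1, by simp, by simp [gammaPath]; grind⟩
  · rintro (x | x | x | x)
    · fin_cases x
      · exact ⟨0, 0, by simp, rfl⟩
      · exact ⟨0, p + 1, by simp, by simp [gammaPath]⟩
    · exact ⟨0, x + 1, by simp, by simp [gammaPath]⟩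
    · exact ⟨1, x + 1, by simp, by simp [gammaPath]⟩
    · exact ⟨2, x + 1, by simp, by simp [gammaPath]⟩

/-- Containing a long theta amounts to containing an induced theta with all path lengths at least
`2` and one at least `3`. -/
theorem not_longThetaFree_iff {V : Type} (G : SimpleGraph V) :
    ¬ LongThetaFree G ↔
      ∃ L f, IsInducedTheta G L f ∧ (∀ i, 2 ≤ L i) ∧ ∃ i, 3 ≤ L i := by
  rw [LongThetaFree, not_not]
  constructor
  · rintro ⟨i, j, k, hi, hj, hk, h3, ⟨e⟩⟩
    have := (isSpanningTheta_gammaGraph (p := i - 1) (q := j - 1) (r := k - 1)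
      (by omega) (by omega) (by omega)).toIsInducedTheta.map e
    refine ⟨_, _, this, ?_, ?_⟩
    · intro l
      fin_cases l <;> simp <;> omega
    · rcases h3 with h3 | h3 | h3
      · exact ⟨0, by simp; omega⟩
      · exact ⟨1, by simp; omega⟩
      · exact ⟨2, by simp; omega⟩
  · rintro ⟨L, f, hf, h2, i, hi⟩
    refine ⟨L 0, L 1, L 2, h2 0, h2 1, h2 2, ?_, ?_⟩
    · fin_cases i
      exacts [.inl hi, .inr (.inl hi), .inr (.inr hi)]
    · have hL : L = ![L 0 - 1 + 1, L 1 - 1 + 1, L 2 - 1 + 1] := by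
        ext i
        have := h2 i
        fin_cases i
        all_goals exact (Nat.sub_add_cancel (by omega)).symm
      have hle : ∀ i, 1 ≤ L i - 1 := fun i => by have := h2 i; omega
      refine (isSpanningTheta_gammaGraph (hle 0) (hle 1) (hle 2)).nonempty_embedding (g := f) ?_
      rwa [← hL]

theorem SimpleGraph.exists_walk_getVert_eq {V : Type} {G : SimpleGraph V} (g : ℕ → V) (n : ℕ)
    (hg : ∀ i < n, G.Adj (g i) (g (i + 1))) :
    ∃ w : G.Walk (g 0) (g n), w.length = n ∧ ∀ i ≤ n, w.getVert i = g i := by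
  induction n with
  | zero => exact ⟨.nil, rfl, fun i hi => by simp [Nat.le_zero.1 hi]⟩
  | succ n ih =>
    obtain ⟨w, hw, hwg⟩ := ih fun i hi => hg i (Nat.lt_succ_of_lt hi)
    refine ⟨w.concat (hg n n.lt_succ_self), by simp [hw], fun i hi => ?_⟩
    rw [SimpleGraph.Walk.concat_eq_append, SimpleGraph.Walk.getVert_append]
    split_ifs with h
    · exact hwg i (hw ▸ h.le)
    · obtain hi' | hi' : i = n ∨ i = n + 1 := by omega
      · rw [hi', hw]; simp
      · rw [hi', hw]; simp

theorem SimpleGraph.exists_isCycle_getVert_eq {V : Type} {G : SimpleGraph V} (g : ℕ → V) (n : ℕ)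
    (hn : 3 ≤ n) (hg : ∀ i < n, G.Adj (g i) (g (i + 1))) (h0 : g n = g 0)
    (hinj : Set.InjOn g (Set.Iio n)) :
    ∃ c : G.Walk (g 0) (g 0), c.IsCycle ∧ c.length = n ∧ ∀ i ≤ n, c.getVert i = g i := by
  obtain ⟨w, hw, hwg⟩ := SimpleGraph.exists_walk_getVert_eq g n hg
  refine ⟨w.copy rfl h0, ?_, by simpa using hw, by simpa using hwg⟩
  rw [SimpleGraph.Walk.isCycle_iff_isPath_tail_and_le_length]
  refine ⟨?_, by simpa [hw] using hn⟩
  rw [← SimpleGraph.Walk.IsPath.getVert_injOn_iff]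
  have hlen : (w.copy rfl h0).tail.length = n - 1 := by simp [hw]
  have hinj' : ∀ i j, i < n → j < n → g (i + 1) = g (j + 1) → i = j := by
    intro i j hi hj hij
    have key : ∀ i, i < n → g (i + 1) = g (if i + 1 = n then 0 else i + 1) := by
      intro i hi
      split_ifs with h
      · rw [h, h0]
      · rfl
    rw [key i hi, key j hj] at hij
    have := hinj (x₁ := if i + 1 = n then 0 else i + 1) (x₂ := if j + 1 = n then 0 else j + 1)
      (by simp only [Set.mem_Iio]; split_ifs <;> omega)
      (by simp only [Set.mem_Iio]; split_ifs <;> omega) hij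
    grind
  intro i hi j hj hij
  simp only [Set.mem_ofPred_eq, hlen] at hi hj
  simp only [SimpleGraph.Walk.getVert_tail, SimpleGraph.Walk.getVert_copy] at hij
  rw [hwg _ (by omega), hwg _ (by omega)] at hij
  exact hinj' i j (by omega) (by omega) hij

theorem IsInducedTheta.hasLongUnichord {V : Type} {G : SimpleGraph V} {L : Fin 3 → ℕ}
    {f : Fin 3 → ℕ → V} (h : IsInducedTheta G L f) (h0 : L 0 = 1) (h1 : 3 ≤ L 1)
    (h2 : 2 ≤ L 2) : HasLongUnichord G := by
  set g : ℕ → V := fun s => if s ≤ L 1 then f 1 s else f 2 (L 1 + L 2 - s) with hg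
  have g1 : ∀ s, s ≤ L 1 → g s = f 1 s := fun s hs => by simp [hg, hs]
  have g2 : ∀ s, s ≤ L 2 → g (L 1 + L 2 - s) = f 2 s := by
    intro s hs
    rcases hs.eq_or_lt with rfl | hs'
    · rw [Nat.add_sub_cancel, g1 _ le_rfl, h.finish_eq]
    · simp only [hg]
      rw [if_neg (by omega)]
      congr 1
      omega
  have g0 : g (L 1 + L 2) = g 0 := by
    rw [g1 0 (Nat.zero_le _), h.start_eq 1 2]
    exact g2 0 (Nat.zero_le _)
  have e1 : ∀ r, r < L 1 → s(f 1 r, f 1 (r + 1)) = s(g r, g (r + 1)) := by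
    intro r hr
    rw [g1 r hr.le, g1 (r + 1) hr]
  have e2 : ∀ r, r < L 2 → ∃ t < L 1 + L 2, s(f 2 r, f 2 (r + 1)) = s(g t, g (t + 1)) := by
    intro r hr
    refine ⟨L 1 + L 2 - (r + 1), by omega, ?_⟩
    have : L 1 + L 2 - (r + 1) + 1 = L 1 + L 2 - r := by omega
    rw [this, g2 r hr.le, g2 (r + 1) hr, Sym2.eq_swap]
  obtain ⟨c, hc, hlen, hcg⟩ := SimpleGraph.exists_isCycle_getVert_eq g (L 1 + L 2) (by omega)
    (fun i hi => by
      by_cases hi1 : i < L 1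
      · rw [g1 i hi1.le, g1 (i + 1) hi1]
        exact h.adj 1 i hi1
      · have := (h.adj 2 (L 1 + L 2 - (i + 1)) (by omega)).symm
        rw [← g2 _ (by omega), ← g2 _ (by omega)] at this
        convert this using 2 <;> omega)
    g0
    (fun i hi j hj hij => by
      simp only [Set.mem_Iio] at hi hj
      have a1 := h.inj 1 1 i j
      have a2 := h.inj 1 2 i (L 1 + L 2 - j)
      have a3 := h.inj 2 1 (L 1 + L 2 - i) j
      have a4 := h.inj 2 2 (L 1 + L 2 - i) (L 1 + L 2 - j)
      simp only [hg] at hij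
      split_ifs at hij
      · grind
      · have := a2 (by omega) (by omega) hij
        simp at this
        omega
      · have := a3 (by omega) (by omega) hij
        simp at this
        omega
      · have := a4 (by omega) (by omega) hij
        omega)
  have mem : ∀ i s, s ≤ L i → f i s ∈ c.support := by
    intro i s hs
    rw [SimpleGraph.Walk.mem_support_iff_exists_getVert]
    have m1 : ∀ s, s ≤ L 1 → ∃ n, c.getVert n = f 1 s ∧ n ≤ c.length := fun s hs =>
      ⟨s, by rw [hcg s (by omega), g1 s hs], by omega⟩
    fin_cases i
    · simp only [Fin.zero_eta, h0] at hs
      interval_cases s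
      · simpa [h.start_eq 0 1] using m1 0 (by omega)
      · have := h.finish_eq 0 1
        rw [h0] at this
        simpa [this] using m1 (L 1) le_rfl
    · exact m1 s hs
    · exact ⟨L 1 + L 2 - s, by rw [hcg _ (by omega)]; exact g2 s hs, by omega⟩
  have memc : ∀ x ∈ c.support, ∃ i s, s ≤ L i ∧ x = f i s := by
    intro x hx
    obtain ⟨n, rfl, hn⟩ := SimpleGraph.Walk.mem_support_iff_exists_getVert.1 hx
    rw [hcg n (by omega)]
    by_cases hn1 : n ≤ L 1
    · exact ⟨1, n, hn1, g1 n hn1⟩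
    · exact ⟨2, L 1 + L 2 - n, by omega, by simp [hg, hn1]⟩
  have edge : ∀ t < L 1 + L 2, s(g t, g (t + 1)) ∈ c.edges := by
    intro t ht
    rw [SimpleGraph.Walk.mk_mem_edges_iff_exists]
    exact ⟨t, by omega, by rw [hcg t ht.le, hcg (t + 1) ht]⟩
  refine ⟨_, c, hc, by omega, f 0 0, f 0 1, mem 0 0 (by omega), mem 0 1 (by omega),
    h.adj 0 0 (by omega), ?_, ?_⟩
  · rw [SimpleGraph.Walk.mk_mem_edges_iff_exists]
    rintro ⟨t, ht, he⟩
    have hL : ∀ i j, i ≠ j → 3 ≤ L i + L j := by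
      intro i j hij
      fin_cases i <;> fin_cases j <;> simp at hij ⊢ <;> omega
    rw [hcg t (by omega), hcg (t + 1) (by omega)] at he
    by_cases ht1 : t < L 1
    · rw [← e1 t ht1] at he
      exact absurd (h.edge_inj hL ht1 (by omega) he).1 (by decide)
    · rw [Sym2.eq_swap, show t = L 1 + L 2 - (L 1 + L 2 - (t + 1) + 1) by omega,
        g2 _ (by omega), show L 1 + L 2 - (L 1 + L 2 - (t + 1) + 1) + 1 =
          L 1 + L 2 - (L 1 + L 2 - (t + 1)) by omega, g2 _ (by omega)] at he
      exact absurd (h.edge_inj hL (by omega) (by omega) he).1 (by decide)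
  · intro x y hx hy hxy hne
    obtain ⟨i, s, hs, rfl⟩ := memc x hx
    obtain ⟨j, t, ht, rfl⟩ := memc y hy
    obtain ⟨k, r, hr, he⟩ := h.chordless i j s t hs ht hxy
    rw [he] at hne ⊢
    fin_cases k
    · obtain rfl : r = 0 := by simp only [Fin.zero_eta, h0] at hr; omega
      rfl
    · exact absurd (e1 r hr ▸ edge r (Nat.lt_add_right _ hr)) hne
    · obtain ⟨t, ht, he⟩ := e2 r hr
      exact absurd (he ▸ edge t ht) hne

theorem HasLongUnichord.exists_isInducedTheta {V : Type} {G : SimpleGraph V}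
    (h : HasLongUnichord G) :
    ∃ L f, IsInducedTheta G L f ∧ L 0 = 1 ∧ 2 ≤ L 1 ∧ 2 ≤ L 2 ∧ 5 ≤ L 1 + L 2 := by
  classical
  obtain ⟨v, c, hc, hlen, a, b, ha, hb, hab, hne, huniq⟩ := h
  obtain ⟨c, hc, hlen, hb, hne, huniq⟩ : ∃ c' : G.Walk a a, c'.IsCycle ∧ 5 ≤ c'.length ∧
      b ∈ c'.support ∧ s(a, b) ∉ c'.edges ∧
      ∀ x y : V, x ∈ c'.support → y ∈ c'.support → G.Adj x y → s(x, y) ∉ c'.edges →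
        s(x, y) = s(a, b) := by
    refine ⟨c.rotate a ha, by simpa using hc, by simpa using hlen, by simpa using hb, ?_, ?_⟩
    · rwa [(c.rotate_edges a ha).mem_iff]
    · intro x y
      rw [(c.rotate_edges a ha).mem_iff, c.mem_support_rotate_iff, c.mem_support_rotate_iff]
      exact huniq x y
  obtain ⟨m, hm, hmle⟩ := SimpleGraph.Walk.mem_support_iff_exists_getVert.1 hb
  obtain ⟨n, hn⟩ : ∃ n, c.length = n := ⟨_, rfl⟩
  rw [hn] at hmle hlen
  have hinj : ∀ s t, s < n → t < n → c.getVert s = c.getVert t → s = t := by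
    intro s t hs ht hst
    exact hc.getVert_injOn' (by simp only [Set.mem_ofPred_eq]; omega)
      (by simp only [Set.mem_ofPred_eq]; omega) hst
  have c0 : c.getVert 0 = a := c.getVert_zero
  have cn : c.getVert n = a := by rw [← hn]; exact c.getVert_length
  have edge : ∀ t < n, s(c.getVert t, c.getVert (t + 1)) ∈ c.edges := fun t ht =>
    c.mk_mem_edges_iff_exists.2 ⟨t, by omega, rfl⟩
  have m0 : m ≠ 0 := by rintro rfl; exact hab.ne (c0.symm.trans hm)
  have m1 : m ≠ 1 := by
    rintro rfl
    exact hne (by simpa [c0, hm] using edge 0 (by omega))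
  have mn : m ≠ n := by rintro rfl; exact hab.ne (cn.symm.trans hm)
  have mn1 : m + 1 ≠ n := by
    intro hmn
    have := edge m (by omega)
    rw [hmn, hm, cn, Sym2.eq_swap] at this
    exact hne this
  refine ⟨![1, m, n - m], ![fun s => if s = 0 then a else b, c.getVert,
    fun s => c.getVert (n - s)], ⟨?_, ?_, ?_, ?_, ?_⟩, rfl, by simp; omega, by simp; omega,
    by simp; omega⟩
  · intro i j
    fin_cases i <;> fin_cases j <;> simp [cn]
  · have : n - (n - m) = m := by omega
    intro i j
    fin_cases i <;> fin_cases j <;> simp [hm, this]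
  · have hinj' : ∀ s t, s ≤ n → t ≤ n → c.getVert s = c.getVert t →
        s = t ∨ s = 0 ∧ t = n ∨ s = n ∧ t = 0 := by
      intro s t hs ht hst
      have h1 := hinj s t
      have h2 := hinj 0 t
      have h3 := hinj s 0
      rcases hs.eq_or_lt with rfl | hs <;> rcases ht.eq_or_lt with rfl | ht <;> grind
    have ha' : ∀ s, s ≤ n → c.getVert s = a → s = 0 ∨ s = n := by
      intro s hs hsa
      have := hinj' s 0 hs (by omega) (hsa.trans c0.symm)
      omega
    have hb' : ∀ s, s ≤ n → c.getVert s = b → s = m := by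
      intro s hs hsa
      have := hinj' s m hs (by omega) (hsa.trans hm.symm)
      omega
    have hab' := hab.ne
    intro i j s t hs ht hst
    fin_cases i <;> fin_cases j <;> simp at hs ht hst ⊢
    · grind
    · grind
    · grind
    · grind
    · have := hinj' _ _ (by omega) (by omega) hst
      omega
    · have := hinj' _ _ (by omega) (by omega) hst
      omega
    · grind
    · have := hinj' _ _ (by omega) (by omega) hst
      omega
    · have := hinj' _ _ (by omega) (by omega) hst
      omega
  · intro i s hs
    fin_cases i <;> simp at hs ⊢
    · simpa [hs] using hab
    · exact c.adj_getVert_succ (by omega)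
    · have := (c.adj_getVert_succ (i := n - (s + 1)) (by omega)).symm
      rwa [show n - (s + 1) + 1 = n - s by omega] at this
  · have mem : ∀ i s, (![fun s => if s = 0 then a else b, c.getVert,
        fun s => c.getVert (n - s)] : Fin 3 → ℕ → V) i s ∈ c.support := by
      intro i s
      fin_cases i <;> simp
      split_ifs
      · simp
      · exact hb
    intro i j s t _ _ hst
    by_cases he : s((![fun s => if s = 0 then a else b, c.getVert,
        fun s => c.getVert (n - s)] : Fin 3 → ℕ → V) i s, (![fun s => if s = 0 then a else b,
        c.getVert, fun s => c.getVert (n - s)] : Fin 3 → ℕ → V) j t) ∈ c.edges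
    · obtain ⟨r, hr, her⟩ := c.mk_mem_edges_iff_exists.1 he
      rw [hn] at hr
      rw [← her]
      by_cases hrm : r < m
      · exact ⟨1, r, hrm, rfl⟩
      · refine ⟨2, n - (r + 1), by simp; omega, ?_⟩
        simp only [Matrix.cons_val]
        rw [Sym2.eq_swap, show n - (n - (r + 1)) = r + 1 by omega,
          show n - (n - (r + 1) + 1) = r by omega]
    · exact ⟨0, 0, by simp, by simpa using huniq _ _ (mem i s) (mem j t) hst he⟩

theorem house_subdivision_free_iff {V : Type} [Fintype V] (G : SimpleGraph V) :
    ¬ ContainsInducedSubdivision house G ↔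
      (¬ HasLongUnichord G ∧ LongThetaFree G) := by
  have hTheta := not_longThetaFree_iff G
  rw [containsInducedSubdivision_house_iff]
  constructor
  · intro h
    refine ⟨fun hu => ?_, ?_⟩
    · obtain ⟨L, f, hf, h0, h1, h2, h3⟩ := hu.exists_isInducedTheta
      by_cases h4 : 3 ≤ L 1
      · exact h ⟨L, f, hf, h0.ge, h4, h2⟩
      · refine h ⟨_, _, hf.perm (Equiv.swap 1 2), ?_⟩
        have e0 : Equiv.swap (1 : Fin 3) 2 0 = 0 := by decide
        simp only [e0, Equiv.swap_apply_left, Equiv.swap_apply_right]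
        omega
    · by_contra hl
      obtain ⟨L, f, hf, h2, i, hi⟩ := hTheta.1 hl
      refine h ⟨_, _, hf.perm (Equiv.swap 1 i), ?_, ?_, h2 _⟩
      · exact (h2 _).trans' one_le_two
      · simpa using hi
  · rintro ⟨hu, hl⟩ ⟨L, f, hf, h0, h1, h2⟩
    rcases h0.eq_or_lt with h0 | h0
    · exact hu (hf.hasLongUnichord h0.symm h1 h2)
    · refine hTheta.2 ⟨L, f, hf, ?_, 1, h1⟩ hl
      intro i
      fin_cases i
      exacts [h0, h1.trans' (by omega), h2]
end
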